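/- arXiv:2406.02712 — 3 statements merged into one kernel-verified Lean document; each statement's English description precedes it below -/
import Mathlib

section
/- Suppose a functional U : 𝒳 → ℝ is concave and upper semicontinuous with respect to the L^∞ norm topology. Then U is Schur concave if and only if U is law-invariant. -/
open MeasureTheory ProbabilityTheory Filter

noncomputable section

variable {Ω : Type*} [MeasurableSpace Ω] (μ : MeasureTheory.Measure Ω) [MeasureTheory.IsProbabilityMeasure μ]

/-- The measure is atomless: every set of positive measure has a subset of strictly
smaller positive measure. -/
def AtomlessMeasure : Prop :=
  ∀ s : Set Ω, MeasurableSet s → μ s ≠ 0 →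
    ∃ t ⊆ s, MeasurableSet t ∧ 0 < μ t ∧ μ t < μ s

/-- The space `𝒳 = L^∞` of essentially bounded random variables. -/
abbrev Xinf : Type _ := Lp ℝ ⊤ μ

variable {μ}

/-- Monotone utility functional on `L^∞`. -/
def UMonotone (U : Xinf μ → ℝ) : Prop :=
  ∀ Z₁ Z₂ : Xinf μ, Z₁ ≤ Z₂ → U Z₁ ≤ U Z₂

/-- Translation invariance. -/
def TranslationInvariant (U : Xinf μ → ℝ) : Prop :=
  ∀ (Z : Xinf μ) (c : ℝ), U (Z + Lp.const ⊤ μ c) = U Z + c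

/-- Law invariance. -/
def LawInvariant (U : Xinf μ → ℝ) : Prop :=
  ∀ Z₁ Z₂ : Xinf μ, IdentDistrib (Z₁ : Ω → ℝ) (Z₂ : Ω → ℝ) μ μ → U Z₁ = U Z₂

/-- Positive homogeneity. -/
def PositivelyHomogeneous (U : Xinf μ → ℝ) : Prop :=
  ∀ (Z : Xinf μ) (t : ℝ), 0 ≤ t → U (t • Z) = t * U Z

/-- Concave order `Z₁ ⪯_ccv Z₂`. -/
def ConcaveOrder (Z₁ Z₂ : Xinf μ) : Prop :=
  ∀ φ : ℝ → ℝ, ConcaveOn ℝ Set.univ φ →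
    ∫ ω, φ (Z₁ ω) ∂μ ≤ ∫ ω, φ (Z₂ ω) ∂μ

/-- Strict concave order `Z₁ ≺_ccv Z₂`. -/
def StrictConcaveOrder (Z₁ Z₂ : Xinf μ) : Prop :=
  ConcaveOrder Z₁ Z₂ ∧
    ∀ φ : ℝ → ℝ, StrictConcaveOn ℝ Set.univ φ →
      ∫ ω, φ (Z₁ ω) ∂μ < ∫ ω, φ (Z₂ ω) ∂μ

/-- Increasing concave order `Z₁ ⪯_icv Z₂`. -/
def IncConcaveOrder (Z₁ Z₂ : Xinf μ) : Prop :=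
  ∀ φ : ℝ → ℝ, Monotone φ → ConcaveOn ℝ Set.univ φ →
    ∫ ω, φ (Z₁ ω) ∂μ ≤ ∫ ω, φ (Z₂ ω) ∂μ

/-- Strict increasing concave order `Z₁ ≺_icv Z₂`. -/
def StrictIncConcaveOrder (Z₁ Z₂ : Xinf μ) : Prop :=
  IncConcaveOrder Z₁ Z₂ ∧
    ∀ φ : ℝ → ℝ, Monotone φ → StrictConcaveOn ℝ Set.univ φ →
      ∫ ω, φ (Z₁ ω) ∂μ < ∫ ω, φ (Z₂ ω) ∂μ

/-- Schur concavity. -/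
def SchurConcave (U : Xinf μ → ℝ) : Prop :=
  ∀ Z₁ Z₂ : Xinf μ, ConcaveOrder Z₁ Z₂ → U Z₁ ≤ U Z₂

/-- Strict Schur concavity. -/
def StrictSchurConcave (U : Xinf μ → ℝ) : Prop :=
  ∀ Z₁ Z₂ : Xinf μ, StrictConcaveOrder Z₁ Z₂ → U Z₁ < U Z₂

/-- S.S.D. preserving. -/
def SSDPreserving (U : Xinf μ → ℝ) : Prop :=
  ∀ Z₁ Z₂ : Xinf μ, IncConcaveOrder Z₁ Z₂ → U Z₁ ≤ U Z₂

/-- Strictly S.S.D. preserving. -/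
def StrictSSDPreserving (U : Xinf μ → ℝ) : Prop :=
  ∀ Z₁ Z₂ : Xinf μ, StrictIncConcaveOrder Z₁ Z₂ → U Z₁ < U Z₂

/-- A tuple of (pointwise defined) random variables is comonotone. -/
def ComonotoneFun {n : ℕ} (Z : Fin n → Ω → ℝ) : Prop :=
  ∀ i j ω₁ ω₂, 0 ≤ (Z i ω₁ - Z i ω₂) * (Z j ω₁ - Z j ω₂)

/-- A tuple of elements of `L^∞` is comonotone if some choice of representatives is. -/
def ComonotoneLp {n : ℕ} (Y : Fin n → Xinf μ) : Prop :=
  ∃ Z : Fin n → Ω → ℝ, (∀ i, (Y i : Ω → ℝ) =ᵐ[μ] Z i) ∧ ComonotoneFun Z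

/-- Assumption 1 of the paper. -/
def Assumption1 {n : ℕ} (U : Fin n → Xinf μ → ℝ) : Prop :=
  ∀ i (Z : Xinf μ),
    Continuous (fun c : ℝ => U i (Z + Lp.const ⊤ μ c)) ∧
    StrictMono (fun c : ℝ => U i (Z + Lp.const ⊤ μ c)) ∧
    Tendsto (fun c : ℝ => U i (Z + Lp.const ⊤ μ c)) atTop atTop

section Alloc

variable {n : ℕ} (U : Fin n → Xinf μ → ℝ) (X : Fin n → Xinf μ)

/-- Allocations of the aggregate endowment `∑ i, X i`. -/
def Alloc : Set (Fin n → Xinf μ) := {Y | ∑ i, Y i = ∑ i, X i}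

/-- Individually rational allocations. -/
def IRset : Set (Fin n → Xinf μ) :=
  {Y | Y ∈ Alloc X ∧ ∀ i, U i (X i) ≤ U i (Y i)}

/-- Pareto-optimal allocations. -/
def POset : Set (Fin n → Xinf μ) :=
  {Y | Y ∈ IRset U X ∧ ¬∃ Y' ∈ IRset U X,
    (∀ i, U i (Y i) ≤ U i (Y' i)) ∧ ∃ j, U j (Y j) < U j (Y' j)}

/-- Weakly Pareto-optimal allocations. -/
def WeakPOset : Set (Fin n → Xinf μ) :=
  {Y | Y ∈ IRset U X ∧ ¬∃ Y' ∈ IRset U X, ∀ i, U i (Y i) < U i (Y' i)}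

/-- Comonotone allocations. -/
def AllocC : Set (Fin n → Xinf μ) := {Y | Y ∈ Alloc X ∧ ComonotoneLp Y}

/-- Comonotone Pareto-optimal allocations. -/
def CPOset : Set (Fin n → Xinf μ) :=
  {Y | Y ∈ IRset U X ∧ ComonotoneLp Y ∧ ¬∃ Y' ∈ IRset U X, ComonotoneLp Y' ∧
    (∀ i, U i (Y i) ≤ U i (Y' i)) ∧ ∃ j, U j (Y j) < U j (Y' j)}

/-- Maximizers of the `λ`-weighted sum of utilities over IR allocations. -/
def SmaxSet (lam : Fin n → ℝ) : Set (Fin n → Xinf μ) :=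
  {Y | Y ∈ IRset U X ∧ ∀ Y' ∈ IRset U X,
    ∑ i, lam i * U i (Y' i) ≤ ∑ i, lam i * U i (Y i)}

/-- Maximizers of the `λ`-weighted sum of utilities over IR comonotone allocations. -/
def CSmaxSet (lam : Fin n → ℝ) : Set (Fin n → Xinf μ) :=
  {Y | Y ∈ IRset U X ∧ ComonotoneLp Y ∧ ∀ Y' ∈ IRset U X, ComonotoneLp Y' →
    ∑ i, lam i * U i (Y' i) ≤ ∑ i, lam i * U i (Y i)}

end Alloc



/-- A distortion function: a nondecreasing map of `[0,1]` into `[0,1]` with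
`T 0 = 0` and `T 1 = 1` (encoded as a function on `ℝ`; only values on `[0,1]` matter). -/
def IsDistortion (T : ℝ → ℝ) : Prop :=
  MonotoneOn T (Set.Icc 0 1) ∧ (∀ x ∈ Set.Icc (0:ℝ) 1, T x ∈ Set.Icc (0:ℝ) 1) ∧
    T 0 = 0 ∧ T 1 = 1

/-- A convex distortion function. -/
def IsConvexDistortion (T : ℝ → ℝ) : Prop :=
  IsDistortion T ∧ ConvexOn ℝ (Set.Icc 0 1) T

/-- A concave distortion function. -/
def IsConcaveDistortion (T : ℝ → ℝ) : Prop :=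
  IsDistortion T ∧ ConcaveOn ℝ (Set.Icc 0 1) T

/-- Sequential closedness under pointwise convergence. -/
def SeqClosedPointwise (𝒯 : Set (ℝ → ℝ)) : Prop :=
  ∀ (T : ℕ → ℝ → ℝ) (T' : ℝ → ℝ), (∀ k, T k ∈ 𝒯) →
    (∀ x, Tendsto (fun k => T k x) atTop (nhds (T' x))) → T' ∈ 𝒯

/-- The Choquet integral `∫ Z d(T ∘ μ)` of a random variable `Z` with respect to
the capacity `T ∘ μ`. -/
def choquet (μ : Measure Ω) (T : ℝ → ℝ) (Z : Ω → ℝ) : ℝ :=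
  (∫ t in Set.Ioi (0:ℝ), T (μ {ω | t < Z ω}).toReal) +
    ∫ t in Set.Iio (0:ℝ), (T (μ {ω | t < Z ω}).toReal - 1)

/-- Choquet integral of an element of `L^∞`. -/
def choquetLp (μ : Measure Ω) [IsProbabilityMeasure μ] (T : ℝ → ℝ) (Z : Lp ℝ ⊤ μ) : ℝ :=
  choquet μ T (Z : Ω → ℝ)

/-- The set `𝒢` of tuples of nondecreasing nonnegative functions on `ℝ₊` summing
to the identity. -/
def Gset (n : ℕ) : Set (Fin n → ℝ → ℝ) :=
  {g | (∀ i, MonotoneOn (g i) (Set.Ici 0)) ∧ (∀ i, ∀ x ≥ (0:ℝ), 0 ≤ g i x) ∧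
    ∀ x ≥ (0:ℝ), ∑ i, g i x = x}

/-- A pair of random variables is comonotone. -/
def ComonotonePair (Z S : Ω → ℝ) : Prop :=
  ∀ ω₁ ω₂, 0 ≤ (Z ω₁ - Z ω₂) * (S ω₁ - S ω₂)

def ComonotonePairLp (Z S : Lp ℝ ⊤ μ) : Prop :=
  ∃ Z' S' : Ω → ℝ, (Z : Ω → ℝ) =ᵐ[μ] Z' ∧ (S : Ω → ℝ) =ᵐ[μ] S' ∧ ComonotonePair Z' S'



/-- The essential infimum `s̲` of an element of `L^∞`. -/
def essInfS (S : Lp ℝ ⊤ μ) : ℝ := essInf (S : Ω → ℝ) μ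

/-- The tail probability `ℙ(S > s̲ + x)`. -/
def tailProbS (S : Lp ℝ ⊤ μ) (x : ℝ) : ℝ :=
  (μ {ω | essInfS S + x < S ω}).toReal

/-- The objective `(T_1,…,T_n) ↦ ∫_0^∞ max_i T_i(ℙ(S > s̲ + x)) dx`. -/
def JobjS {n : ℕ} (S : Lp ℝ ⊤ μ) (T : Fin n → ℝ → ℝ) : ℝ :=
  ∫ x in Set.Ioi (0:ℝ), ⨆ i, T i (tailProbS S x)

open Classical in
/-- The set `L_x` of agents attaining the maximum `max_j T_j(ℙ(S > s̲ + x))`. -/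
def Lset {n : ℕ} (S : Lp ℝ ⊤ μ) (T : Fin n → ℝ → ℝ) (x : ℝ) : Finset (Fin n) :=
  Finset.univ.filter (fun i => T i (tailProbS S x) = ⨆ j, T j (tailProbS S x))


/-- Every non-null measurable set can be split properly;
`AtomlessMeasure` for a general measure. -/
def ProperlySplitting {Ω : Type*} [MeasurableSpace Ω] (ν : Measure Ω) : Prop :=
  ∀ s : Set Ω, MeasurableSet s → ν s ≠ 0 → ∃ t ⊆ s, MeasurableSet t ∧ 0 < ν t ∧ ν t < ν s

theorem ProperlySplitting.restrict {Ω : Type*} [MeasurableSpace Ω] {ν : Measure Ω}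
    (h : ProperlySplitting ν) {A : Set Ω} (hA : MeasurableSet A) :
    ProperlySplitting (ν.restrict A) := by
  intro s hs hne
  rw [Measure.restrict_apply hs] at hne
  obtain ⟨t, hts, ht, h0, hlt⟩ := h _ (hs.inter hA) hne
  have : t ∩ A = t := Set.inter_eq_left.2 (hts.trans Set.inter_subset_right)
  refine ⟨t, hts.trans Set.inter_subset_left, ht, ?_, ?_⟩
  · rwa [Measure.restrict_apply ht, this]
  · rwa [Measure.restrict_apply ht, Measure.restrict_apply hs, this]

section Chain

variable {Ω : Type*} [MeasurableSpace Ω] {ν : Measure Ω}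

/-- A maximal family of measurable sets that is totally ordered by almost sure inclusion. -/
structure IsMaxAEChain (ν : Measure Ω) (M : Set (Set Ω)) : Prop where
  meas : ∀ E ∈ M, MeasurableSet E
  total : ∀ E ∈ M, ∀ F ∈ M, E ≤ᵐ[ν] F ∨ F ≤ᵐ[ν] E
  mem : ∀ E, MeasurableSet E → (∀ F ∈ M, E ≤ᵐ[ν] F ∨ F ≤ᵐ[ν] E) → E ∈ M

theorem exists_isMaxAEChain (c : Set (Set Ω)) (hm : ∀ E ∈ c, MeasurableSet E)
    (hc : ∀ E ∈ c, ∀ F ∈ c, E ≤ᵐ[ν] F ∨ F ≤ᵐ[ν] E) : ∃ M, IsMaxAEChain ν M ∧ c ⊆ M := by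
  let r : {s : Set Ω // MeasurableSet s} → {s : Set Ω // MeasurableSet s} → Prop :=
    fun E F => E.1 ≤ᵐ[ν] F.1
  have hch : IsChain r {E | E.1 ∈ c} := fun E hE F hF _ => hc _ hE _ hF
  obtain ⟨M, hM, hcM⟩ := hch.exists_maxChain
  have htot : ∀ E ∈ M, ∀ F ∈ M, r E F ∨ r F E := by
    intro E hE F hF
    by_cases h : E = F
    · subst h; exact Or.inl (EventuallyLE.refl _ _)
    · exact hM.1 hE hF h
  refine ⟨Subtype.val '' M, ⟨?_, ?_, ?_⟩, fun E hE => ⟨⟨E, hm E hE⟩, hcM hE, rfl⟩⟩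
  · rintro _ ⟨E, -, rfl⟩; exact E.2
  · rintro _ ⟨E, hE, rfl⟩ _ ⟨F, hF, rfl⟩; exact htot E hE F hF
  · intro E hE h
    have := hM.2 (hM.1.insert (a := ⟨E, hE⟩) fun b hb _ => h b.1 ⟨b, hb, rfl⟩)
      (Set.subset_insert _ _)
    exact ⟨⟨E, hE⟩, this ▸ Set.mem_insert _ _, rfl⟩

variable [IsFiniteMeasure ν]

theorem IsMaxAEChain.ae_le {M : Set (Set Ω)} (hM : IsMaxAEChain ν M) {E F : Set Ω} (hE : E ∈ M)
    (hF : F ∈ M) (h : ν E ≤ ν F) : E ≤ᵐ[ν] F := by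
  rcases hM.total E hE F hF with h' | h'
  · exact h'
  · exact (ae_eq_of_ae_subset_of_measure_ge h' h (hM.meas F hF).nullMeasurableSet
      (measure_ne_top ν E)).symm.le

theorem IsMaxAEChain.exists_sup {M : Set (Set Ω)} (hM : IsMaxAEChain ν M) (r : ENNReal) :
    ∃ L ∈ M, ν L ≤ r ∧ ∀ F ∈ M, ν F ≤ r → F ≤ᵐ[ν] L := by
  have h0 : ∅ ∈ M := hM.mem _ MeasurableSet.empty fun F _ =>
    Or.inl (Set.empty_subset F).eventuallyLE
  obtain ⟨u, hu, hlim, hmem⟩ := exists_seq_tendsto_sSup (S := {x | ∃ E ∈ M, ν E = x ∧ x ≤ r})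
    ⟨_, ∅, h0, rfl, by simp⟩ (OrderTop.bddAbove _)
  choose E hE hEu hur using hmem
  have hL : (⋃ n, E n) ∈ M := by
    refine hM.mem _ (MeasurableSet.iUnion fun n => hM.meas _ (hE n)) fun F hF => ?_
    by_cases h : ∃ n, F ≤ᵐ[ν] E n
    · obtain ⟨n, hn⟩ := h
      exact Or.inr (hn.trans (Set.subset_iUnion E n).eventuallyLE)
    · push Not at h
      have h' : ∀ n, E n ≤ᵐ[ν] F := fun n => (hM.total _ (hE n) F hF).resolve_right (h n)
      left
      filter_upwards [ae_all_iff.2 h'] with ω hω h1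
      obtain ⟨n, hn⟩ := Set.mem_iUnion.1 h1
      exact hω n hn
  refine ⟨_, hL, ?_, fun F hF hr => hM.ae_le hF hL ?_⟩
  · refine le_of_tendsto' (tendsto_measure_iUnion_accumulate (μ := ν) (f := E)) fun n => ?_
    refine (measure_mono_ae ?_).trans ((hEu n).le.trans (hur n))
    have h' : ∀ i ≤ n, E i ≤ᵐ[ν] E n := fun i hi =>
      hM.ae_le (hE i) (hE n) (by rw [hEu, hEu]; exact hu hi)
    have h'' := (ae_all_iff (μ := ν)).2 fun i => (ae_all_iff (μ := ν)).2 (h' i)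
    filter_upwards [h''] with ω hω h1
    obtain ⟨i, hi, hi'⟩ := Set.mem_accumulate.1 h1
    exact hω i hi hi'
  · refine (le_sSup (show _ ∈ {x | ∃ E ∈ M, ν E = x ∧ x ≤ r} from
      ⟨F, hF, rfl, hr⟩)).trans (le_of_tendsto' hlim fun n => ?_)
    rw [← hEu]
    exact measure_mono (Set.subset_iUnion E n)

theorem IsMaxAEChain.exists_inf {M : Set (Set Ω)} (hM : IsMaxAEChain ν M) {r : ENNReal}
    (hr : r ≤ ν Set.univ) :
    ∃ R ∈ M, r ≤ ν R ∧ ∀ F ∈ M, r ≤ ν F → R ≤ᵐ[ν] F := by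
  have h0 : Set.univ ∈ M := hM.mem _ MeasurableSet.univ fun F _ =>
    Or.inr (Set.subset_univ F).eventuallyLE
  obtain ⟨u, hu, hlim, hmem⟩ := exists_seq_tendsto_sInf (S := {x | ∃ E ∈ M, ν E = x ∧ r ≤ x})
    ⟨_, Set.univ, h0, rfl, hr⟩ (OrderBot.bddBelow _)
  choose E hE hEu hur using hmem
  have hR : (⋂ n, E n) ∈ M := by
    refine hM.mem _ (MeasurableSet.iInter fun n => hM.meas _ (hE n)) fun F hF => ?_
    by_cases h : ∃ n, E n ≤ᵐ[ν] F
    · obtain ⟨n, hn⟩ := h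
      exact Or.inl ((Set.iInter_subset E n).eventuallyLE.trans hn)
    · push Not at h
      have h' : ∀ n, F ≤ᵐ[ν] E n := fun n => (hM.total _ (hE n) F hF).resolve_left (h n)
      right
      filter_upwards [ae_all_iff.2 h'] with ω hω h1
      exact Set.mem_iInter.2 fun n => hω n h1
  refine ⟨_, hR, ?_, fun F hF hr => hM.ae_le hR hF ?_⟩
  · refine ge_of_tendsto' (tendsto_measure_iInter_le (μ := ν) (f := E)
      (fun n => (hM.meas _ (hE n)).nullMeasurableSet) ⟨0, measure_ne_top _ _⟩) fun n => ?_
    refine ((hur n).trans (hEu n).ge).trans (measure_mono_ae ?_)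
    have h' : ∀ i ≤ n, E n ≤ᵐ[ν] E i := fun i hi =>
      hM.ae_le (hE n) (hE i) (by rw [hEu, hEu]; exact hu hi)
    have h'' := (ae_all_iff (μ := ν)).2 fun i => (ae_all_iff (μ := ν)).2 (h' i)
    filter_upwards [h''] with ω hω h1
    exact Set.mem_iInter₂.2 fun i hi => hω i hi h1
  · refine (ge_of_tendsto' hlim fun n => ?_).trans
      (sInf_le (show _ ∈ {x | ∃ E ∈ M, ν E = x ∧ r ≤ x} from
      ⟨F, hF, rfl, hr⟩))
    rw [← hEu]
    exact measure_mono (Set.iInter_subset E n)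

theorem IsMaxAEChain.exists_measure_eq {M : Set (Set Ω)} (hM : IsMaxAEChain ν M)
    (hν : ProperlySplitting ν) {r : ENNReal} (hr : r ≤ ν Set.univ) : ∃ E ∈ M, ν E = r := by
  obtain ⟨L, hL, hLr, hLmax⟩ := hM.exists_sup r
  obtain ⟨R, hR, hRr, hRmin⟩ := hM.exists_inf hr
  by_contra! hne
  have hL' : ν L < r := lt_of_le_of_ne hLr (hne L hL)
  have hR' : r < ν R := lt_of_le_of_ne hRr (hne R hR).symm
  have hLR : L ≤ᵐ[ν] R := hM.ae_le hL hR (hL'.trans hR').le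
  have hpos : ν (R \ L) ≠ 0 := by
    intro h
    have : R ≤ᵐ[ν] L := ae_le_set.2 h
    exact absurd (measure_mono_ae this) (hL'.trans hR').not_ge
  obtain ⟨t, ht, htm, ht0, hlt⟩ := hν _ ((hM.meas R hR).diff (hM.meas L hL)) hpos
  have hmem : L ∪ t ∈ M := by
    refine hM.mem _ ((hM.meas L hL).union htm) fun F hF => ?_
    rcases le_total (ν F) r with h | h
    · exact Or.inr ((hLmax F hF h).trans Set.subset_union_left.eventuallyLE)
    · left
      filter_upwards [hLR, hRmin F hF h] with ω h1 h2 h3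
      rcases h3 with h3 | h3
      · exact h2 (h1 h3)
      · exact h2 (ht h3).1
  rcases le_total (ν (L ∪ t)) r with h | h
  · refine ht0.ne' (measure_eq_zero_iff_ae_notMem.2 ?_)
    filter_upwards [hLmax _ hmem h] with ω h1 h2
    exact (ht h2).2 (h1 (Or.inr h2))
  · refine hlt.not_ge (measure_mono_ae ?_)
    filter_upwards [hRmin _ hmem h] with ω h1 h2
    exact (h1 h2.1).resolve_left h2.2

/-- A nested family of measurable sets of every given measure, compatible with the level
sets of a function. -/
theorem exists_nested_family (hν : ProperlySplitting ν) (f : Ω → ℝ) (hf : Measurable f) :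
    ∃ E : ENNReal → Set Ω, ∀ r ≤ ν Set.univ, MeasurableSet (E r) ∧ ν (E r) = r ∧
      (∀ r' ≤ r, E r' ≤ᵐ[ν] E r) ∧
      ∀ c, E r ≤ᵐ[ν] {ω | f ω < c} ∨ {ω | f ω < c} ≤ᵐ[ν] E r := by
  obtain ⟨M, hM, hcM⟩ := exists_isMaxAEChain (ν := ν) (Set.range fun c : ℝ => {ω | f ω < c})
    (by rintro _ ⟨c, rfl⟩; exact measurableSet_lt hf measurable_const)
    (by
      rintro _ ⟨c, rfl⟩ _ ⟨d, rfl⟩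
      rcases le_total c d with h | h
      · exact Or.inl (Eventually.of_forall fun ω (hω : f ω < c) => hω.trans_le h)
      · exact Or.inr (Eventually.of_forall fun ω (hω : f ω < d) => hω.trans_le h))
  choose! E hE hEr using fun (r : ENNReal) (hr : r ≤ ν Set.univ) => hM.exists_measure_eq hν hr
  refine ⟨E, fun r hr => ⟨hM.meas _ (hE r hr), hEr r hr, fun r' hr' => ?_, fun c => ?_⟩⟩
  · exact hM.ae_le (hE _ (hr'.trans hr)) (hE r hr)
      (by rwa [hEr _ (hr'.trans hr), hEr r hr])
  · exact hM.total _ (hE r hr) _ (hcM ⟨c, rfl⟩)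

end Chain

section Rearrangement

variable {Ω : Type*} [MeasurableSpace Ω] {ν : Measure Ω}

/-- If the strict sublevel sets of `g` are all comparable with `B`, then a constant separates
the values of `g` on `B` from those off `B`. -/
theorem exists_separating_value {g : Ω → ℝ} {a b : ℝ} (hab : a ≤ b)
    (hg : ∀ᵐ ω ∂ν, a ≤ g ω ∧ g ω ≤ b) (B : Set Ω)
    (hB : ∀ c, B ≤ᵐ[ν] {ω | g ω < c} ∨ {ω | g ω < c} ≤ᵐ[ν] B) :
    ∃ c ∈ Set.Icc a b, ∀ᵐ ω ∂ν, (ω ∈ B → g ω ≤ c) ∧ (ω ∉ B → c ≤ g ω) := by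
  let S : Set ℝ := {c | c ∈ Set.Icc a b ∧ (c = a ∨ {ω | g ω < c} ≤ᵐ[ν] B)}
  have haS : a ∈ S := ⟨⟨le_rfl, hab⟩, Or.inl rfl⟩
  have hbdd : BddAbove S := ⟨b, fun c hc => hc.1.2⟩
  obtain ⟨u, -, hu, huS⟩ := exists_seq_tendsto_sSup ⟨a, haS⟩ hbdd
  obtain ⟨v, -, hv, hvlim⟩ := exists_seq_strictAnti_tendsto (sSup S)
  refine ⟨sSup S, ⟨le_csSup hbdd haS, csSup_le ⟨a, haS⟩ fun c hc => hc.1.2⟩, ?_⟩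
  have h1 : ∀ n, ∀ᵐ ω ∂ν, ω ∉ B → u n ≤ g ω := by
    intro n
    rcases (huS n).2 with h | h
    · filter_upwards [hg] with ω hω _
      exact h ▸ hω.1
    · filter_upwards [h] with ω hω hωB
      by_contra hlt
      exact hωB (hω (not_le.1 hlt))
  have h2 : ∀ n, ∀ᵐ ω ∂ν, ω ∈ B → g ω ≤ v n := by
    intro n
    rcases lt_or_ge b (v n) with h | h
    · filter_upwards [hg] with ω hω _
      exact hω.2.trans h.le
    · have hnot : v n ∉ S := fun hmem => (hv n).not_ge (le_csSup hbdd hmem)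
      have hav : a ≤ v n := (le_csSup hbdd haS).trans (hv n).le
      have : ¬ ({ω | g ω < v n} ≤ᵐ[ν] B) := fun hc => hnot ⟨⟨hav, h⟩, Or.inr hc⟩
      filter_upwards [(hB (v n)).resolve_right this] with ω hω hωB
      exact (hω hωB).le
  filter_upwards [ae_all_iff.2 h1, ae_all_iff.2 h2] with ω hω1 hω2
  exact ⟨fun h => ge_of_tendsto' hvlim fun n => hω2 n h,
    fun h => le_of_tendsto' hu fun n => hω1 n h⟩

theorem map_piecewise_eq {f g h : Ω → ℝ} [∀ (s : Set Ω) ω, Decidable (ω ∈ s)] {D : Set Ω}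
    (hD : MeasurableSet D) (hf : Measurable f) (hg : Measurable g) (hh : Measurable h)
    {D₁ D₂ : Set Ω} (hsum : ν.restrict D₁ + ν.restrict D₂ = ν)
    (h₁ : (ν.restrict D).map g = (ν.restrict D₁).map f)
    (h₂ : (ν.restrict Dᶜ).map h = (ν.restrict D₂).map f) :
    ν.map (D.piecewise g h) = ν.map f := by
  have hp : Measurable (D.piecewise g h) := Measurable.piecewise hD hg hh
  conv_lhs => rw [← Measure.restrict_add_restrict_compl (μ := ν) hD]
  rw [Measure.map_add _ _ hp, Measure.map_congr (piecewise_ae_eq_restrict hD),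
    Measure.map_congr (piecewise_ae_eq_restrict_compl hD), h₁, h₂, ← Measure.map_add _ _ hf, hsum]

theorem ae_mem_Icc_of_map_eq {Ω' : Type*} [MeasurableSpace Ω'] {ν' : Measure Ω'} {f : Ω → ℝ}
    {g : Ω' → ℝ} (hf : Measurable f) (hg : Measurable g) (h : ν.map f = ν'.map g) {a b : ℝ}
    (hb : ∀ᵐ ω ∂ν, a ≤ f ω ∧ f ω ≤ b) : ∀ᵐ ω ∂ν', a ≤ g ω ∧ g ω ≤ b := by
  have hm : MeasurableSet {x : ℝ | a ≤ x ∧ x ≤ b} := measurableSet_Icc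
  rw [← ae_map_iff hg.aemeasurable hm, ← h, ae_map_iff hf.aemeasurable hm]
  exact hb

variable [IsFiniteMeasure ν]

/-- On an atomless measure space, a compactly supported law on `ℝ` is realised by a function
that is comonotone with a given function. -/
theorem exists_map_eq_comonotone (hν : ProperlySplitting ν) {β : Ω → ℝ} (hβ : Measurable β)
    (ρ : Measure ℝ) [IsFiniteMeasure ρ] (hmass : ρ Set.univ = ν Set.univ) {a b : ℝ} (hab : a ≤ b)
    (hρ : ∀ᵐ x ∂ρ, a ≤ x ∧ x ≤ b) :
    ∃ g : Ω → ℝ, Measurable g ∧ ν.map g = ρ ∧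
      ∀ t, ∃ c, ∀ᵐ ω ∂ν, (β ω < t → g ω ≤ c) ∧ (t ≤ β ω → c ≤ g ω) := by
  classical
  obtain ⟨E, hE⟩ := exists_nested_family hν β hβ
  have hle : ∀ s : Set ℝ, ρ s ≤ ν Set.univ := fun s => hmass ▸ measure_mono (Set.subset_univ s)
  let G : ℚ → Set Ω := fun c => E (ρ (Set.Iic (c : ℝ)))
  have hGm : ∀ c, MeasurableSet (G c) := fun c => (hE _ (hle _)).1
  let k : ℚ → Ω → ℝ := fun c => (G c).piecewise (fun _ => max a (min c b)) (fun _ => b)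
  have hka : ∀ c ω, a ≤ k c ω := by
    intro c ω
    by_cases h : ω ∈ G c
    · simp [k, h]
    · simpa [k, h] using hab
  have hbdd : ∀ ω, BddBelow (Set.range fun c => k c ω) := fun ω =>
    ⟨a, by rintro _ ⟨c, rfl⟩; exact hka c ω⟩
  let g : Ω → ℝ := fun ω => ⨅ c, k c ω
  have hgm : Measurable g :=
    Measurable.iInf fun c => Measurable.piecewise (hGm c) measurable_const measurable_const
  have hga : ∀ ω, a ≤ g ω := fun ω => le_ciInf fun c => hka c ω
  have hgb : ∀ ω, g ω ≤ b := by
    intro ω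
    refine (ciInf_le (hbdd ω) 0).trans ?_
    by_cases h : ω ∈ G 0
    · simp [k, h, hab]
    · simp [k, h]
  have hlt : ∀ x, a < x → x ≤ b → {ω | g ω < x} = ⋃ c : {c : ℚ // (c : ℝ) < x}, G c := by
    intro x hax hxb
    ext ω
    simp only [Set.mem_ofPred_eq, Set.mem_iUnion, g, ciInf_lt_iff (hbdd ω)]
    constructor
    · rintro ⟨c, hc⟩
      by_cases h : ω ∈ G c
      · refine ⟨⟨c, ?_⟩, h⟩
        simp only [k, h, Set.piecewise_eq_of_mem, max_lt_iff, min_lt_iff] at hc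
        exact hc.2.resolve_right hxb.not_gt
      · simp only [k, h, not_false_iff, Set.piecewise_eq_of_notMem] at hc
        exact absurd hc hxb.not_gt
    · rintro ⟨⟨c, hc⟩, h⟩
      refine ⟨c, ?_⟩
      simp only at h
      simp only [k, h, Set.piecewise_eq_of_mem, max_lt_iff, min_lt_iff]
      exact ⟨hax, Or.inl hc⟩
  have hlow : ∀ x, x ≤ a → {ω | g ω < x} = ∅ := fun x hx =>
    Set.eq_empty_of_forall_notMem fun ω hω => ((hx.trans (hga ω)).not_gt hω)
  have hhigh : ∀ x, b < x → {ω | g ω < x} = Set.univ := fun x hx =>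
    Set.eq_univ_of_forall fun ω => (hgb ω).trans_lt hx
  have hmeas : ∀ x, ν {ω | g ω < x} = ρ (Set.Iio x) := by
    intro x
    rcases le_or_gt x a with hxa | hxa
    · rw [hlow x hxa, measure_empty, eq_comm, measure_eq_zero_iff_ae_notMem]
      filter_upwards [hρ] with y hy
      exact not_lt.2 (hxa.trans hy.1)
    rcases lt_or_ge b x with hxb | hxb
    · rw [hhigh x hxb, ← hmass]
      refine measure_congr ?_
      filter_upwards [hρ] with y hy
      exact propext ⟨fun _ => hy.2.trans_lt hxb, fun _ => trivial⟩
    rw [hlt x hxa hxb]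
    refine le_antisymm ?_ ?_
    · obtain ⟨-, h1, h2, -⟩ := hE _ (hle (Set.Iio x))
      rw [← h1]
      refine measure_mono_ae ?_
      have := fun c : {c : ℚ // (c : ℝ) < x} => h2 (ρ (Set.Iic (c : ℝ)))
        (measure_mono fun y (hy : y ≤ c) => lt_of_le_of_lt hy c.2)
      filter_upwards [ae_all_iff.2 this] with ω hω hmem
      obtain ⟨c, hc⟩ := Set.mem_iUnion.1 hmem
      exact hω c hc
    · have hU : Set.Iio x = ⋃ c : {c : ℚ // (c : ℝ) < x}, Set.Iic (c : ℝ) := by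
        ext y
        simp only [Set.mem_Iio, Set.mem_iUnion, Set.mem_Iic]
        constructor
        · intro hy
          obtain ⟨q, hq1, hq2⟩ := exists_rat_btwn hy
          exact ⟨⟨q, hq2⟩, hq1.le⟩
        · rintro ⟨c, hc⟩
          exact hc.trans_lt c.2
      have hmono : Monotone fun c : {c : ℚ // (c : ℝ) < x} => Set.Iic (c : ℝ) :=
        fun c d hcd => Set.Iic_subset_Iic.2 (by exact_mod_cast hcd)
      rw [hU, hmono.directed_le.measure_iUnion]
      refine iSup_le fun c => ?_
      rw [← (hE _ (hle (Set.Iic (c : ℝ)))).2.1]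
      exact measure_mono (Set.subset_iUnion (fun c : {c : ℚ // (c : ℝ) < x} => G c) c)
  refine ⟨g, hgm, ?_, fun t => ?_⟩
  · refine Measure.ext_of_Ici _ _ fun x => ?_
    rw [← Set.compl_Iio, measure_compl measurableSet_Iio (measure_ne_top _ _),
      measure_compl measurableSet_Iio (measure_ne_top _ _), Measure.map_apply hgm .univ,
      Measure.map_apply hgm measurableSet_Iio, hmass, Set.preimage_univ]
    congr 1
    exact hmeas x
  · obtain ⟨c, -, hc⟩ := exists_separating_value (ν := ν) hab
      (Eventually.of_forall fun ω => ⟨hga ω, hgb ω⟩) {ω | β ω < t} (by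
        intro x
        rcases le_or_gt x a with hxa | hxa
        · rw [hlow x hxa]
          exact Or.inr (Set.empty_subset _).eventuallyLE
        rcases lt_or_ge b x with hxb | hxb
        · rw [hhigh x hxb]
          exact Or.inl (Set.subset_univ _).eventuallyLE
        rw [hlt x hxa hxb]
        by_cases h : ∃ c : {c : ℚ // (c : ℝ) < x}, {ω | β ω < t} ≤ᵐ[ν] G c
        · obtain ⟨c, hc⟩ := h
          exact Or.inl (hc.trans
            (Set.subset_iUnion (fun c : {c : ℚ // (c : ℝ) < x} => G c) c).eventuallyLE)
        · push Not at h
          have h' := fun c : {c : ℚ // (c : ℝ) < x} =>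
            ((hE _ (hle (Set.Iic (c : ℝ)))).2.2.2 t).resolve_right (h c)
          right
          filter_upwards [ae_all_iff.2 h'] with ω hω hmem
          obtain ⟨c, hc⟩ := Set.mem_iUnion.1 hmem
          exact hω c hc)
    refine ⟨c, ?_⟩
    filter_upwards [hc] with ω hω
    exact ⟨hω.1, fun h => hω.2 (not_lt.2 h)⟩

/-- A bounded function has a rearrangement whose average with it has half the range. -/
theorem exists_rearrangement_half_range (hν : ProperlySplitting ν) {f : Ω → ℝ} (hf : Measurable f)
    {a b : ℝ} (hab : a ≤ b) (hfb : ∀ᵐ ω ∂ν, a ≤ f ω ∧ f ω ≤ b) :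
    ∃ g : Ω → ℝ, Measurable g ∧ ν.map g = ν.map f ∧ ∃ a' b', a' ≤ b' ∧ b' - a' = (b - a) / 2 ∧
      ∀ᵐ ω ∂ν, a' ≤ (f ω + g ω) / 2 ∧ (f ω + g ω) / 2 ≤ b' := by
  classical
  obtain ⟨E, hE⟩ := exists_nested_family hν f hf
  obtain ⟨hDm, hDν, -, hDc⟩ := hE (ν Set.univ / 2) ENNReal.half_le_self
  set D := E (ν Set.univ / 2)
  have hDν' : ν Dᶜ = ν D := by
    rw [measure_compl hDm (measure_ne_top _ _), hDν]
    exact ENNReal.sub_half (measure_ne_top _ _)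
  obtain ⟨c, ⟨hac, hcb⟩, hc⟩ := exists_separating_value hab hfb D hDc
  have hlo : ∀ᵐ ω ∂ν.restrict D, a ≤ f ω ∧ f ω ≤ c := by
    rw [ae_restrict_iff' hDm]
    filter_upwards [hfb, hc] with ω h1 h2 h3
    exact ⟨h1.1, h2.1 h3⟩
  have hhi : ∀ᵐ ω ∂ν.restrict Dᶜ, c ≤ f ω ∧ f ω ≤ b := by
    rw [ae_restrict_iff' hDm.compl]
    filter_upwards [hfb, hc] with ω h1 h2 h3
    exact ⟨h2.2 h3, h1.2⟩
  have hmass : ∀ s t : Set Ω, ν s = ν t →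
      (ν.restrict s).map f Set.univ = ν.restrict t Set.univ := by
    intro s t h
    rw [Measure.map_apply hf .univ, Set.preimage_univ, Measure.restrict_apply_univ,
      Measure.restrict_apply_univ, h]
  obtain ⟨g, hgm, hg, -⟩ := exists_map_eq_comonotone (hν.restrict hDm) measurable_const (β := 0)
    ((ν.restrict Dᶜ).map f) (hmass _ _ hDν') hcb
    ((ae_map_iff hf.aemeasurable measurableSet_Icc).2 hhi)
  obtain ⟨h, hhm, hh, -⟩ := exists_map_eq_comonotone (hν.restrict hDm.compl) measurable_const
    (β := 0) ((ν.restrict D).map f) (hmass _ _ hDν'.symm) hac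
    ((ae_map_iff hf.aemeasurable measurableSet_Icc).2 hlo)
  refine ⟨D.piecewise g h, Measurable.piecewise hDm hgm hhm,
    map_piecewise_eq hDm hf hgm hhm (Measure.restrict_compl_add_restrict hDm) hg hh,
    (a + c) / 2, (c + b) / 2, by linarith, by ring, ?_⟩
  have hg' := (ae_restrict_iff' hDm).1 (ae_mem_Icc_of_map_eq hf hgm hg.symm hhi)
  have hh' := (ae_restrict_iff' hDm.compl).1 (ae_mem_Icc_of_map_eq hf hhm hh.symm hlo)
  filter_upwards [hg', hh', (ae_restrict_iff' hDm).1 hlo, (ae_restrict_iff' hDm.compl).1 hhi]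
    with ω h1 h2 h3 h4
  by_cases hω : ω ∈ D
  · rw [Set.piecewise_eq_of_mem _ _ _ hω]
    constructor <;> linarith [h1 hω, h3 hω]
  · rw [Set.piecewise_eq_of_notMem _ _ _ hω]
    constructor <;> linarith [h2 hω, h4 hω]

end Rearrangement

section LawInvariantClass

variable {Ω : Type*} [MeasurableSpace Ω] {μ : Measure Ω}

/-- A class of functions that is convex, law-invariant and closed under uniform limits. -/
structure LawInvariantClass (μ : Measure Ω) (P : (Ω → ℝ) → Prop) : Prop where
  convex : ∀ f g, P f → P g → ∀ a b : ℝ, 0 ≤ a → 0 ≤ b → a + b = 1 →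
    P fun ω => a * f ω + b * g ω
  law : ∀ f g, P f → Measurable f → Measurable g → μ.map g = μ.map f → P g
  closed : ∀ f, Measurable f → (∀ ε > 0, ∃ g, P g ∧ ∀ᵐ ω ∂μ, |f ω - g ω| ≤ ε) → P f

variable {P : (Ω → ℝ) → Prop}

theorem LawInvariantClass.congr (hP : LawInvariantClass μ P) {f g : Ω → ℝ} (hPf : P f)
    (hf : Measurable f) (hg : Measurable g) (h : g =ᵐ[μ] f) : P g :=
  hP.law f g hPf hf hg (Measure.map_congr h)

variable [IsProbabilityMeasure μ]

theorem integrable_of_ae_abs_le {f : Ω → ℝ} (hf : Measurable f) {M : ℝ}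
    (hM : ∀ᵐ ω ∂μ, |f ω| ≤ M) : Integrable f μ :=
  Integrable.of_bound hf.aestronglyMeasurable M hM

theorem setAverage_mem_Icc {f : Ω → ℝ} {A : Set Ω} (hA : μ A ≠ 0) (hf : IntegrableOn f A μ)
    {a b : ℝ} (hfb : ∀ᵐ ω ∂μ.restrict A, a ≤ f ω ∧ f ω ≤ b) :
    (⨍ ω in A, f ω ∂μ) ∈ Set.Icc a b :=
  (convex_Icc a b).set_average_mem isClosed_Icc hA (measure_ne_top _ _) hfb hf

theorem LawInvariantClass.exists_small_range (hP : LawInvariantClass μ P)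
    (hμ : ProperlySplitting μ) {f : Ω → ℝ} (hPf : P f) (hf : Measurable f) {M : ℝ} (hM0 : 0 ≤ M)
    (hM : ∀ᵐ ω ∂μ, |f ω| ≤ M) {A : Set Ω} (hA : MeasurableSet A) (n : ℕ) :
    ∃ g, P g ∧ Measurable g ∧ (∀ ω ∉ A, g ω = f ω) ∧ ∫ ω in A, g ω ∂μ = ∫ ω in A, f ω ∂μ ∧
      ∃ a b, a ≤ b ∧ b - a = 2 * M / 2 ^ n ∧ ∀ᵐ ω ∂μ.restrict A, a ≤ g ω ∧ g ω ≤ b := by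
  classical
  induction n with
  | zero =>
    refine ⟨f, hPf, hf, fun _ _ => rfl, rfl, -M, M, by linarith, by ring, ?_⟩
    filter_upwards [ae_restrict_of_ae hM] with ω hω
    exact abs_le.1 hω
  | succ n ih =>
    obtain ⟨g, hPg, hg, hgA, hgi, a, b, hab, hba, hgb⟩ := ih
    obtain ⟨k, hk, hkmap, a', b', hab', hba', hkb⟩ :=
      exists_rearrangement_half_range (hμ.restrict hA) hg hab hgb
    have hG : μ.map (A.piecewise k g) = μ.map g :=
      map_piecewise_eq hA hg hk hg (Measure.restrict_add_restrict_compl hA) hkmap rfl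
    have hGm : Measurable (A.piecewise k g) := Measurable.piecewise hA hk hg
    have hkb' := ae_mem_Icc_of_map_eq hg hk hkmap.symm hgb
    refine ⟨_, hP.convex g _ hPg (hP.law _ _ hPg hg hGm hG) (1 / 2) (1 / 2) (by norm_num)
      (by norm_num) (by norm_num), (hg.const_mul _).add (hGm.const_mul _), ?_, ?_,
      a', b', hab', by rw [hba', hba]; ring, ?_⟩
    · intro ω hω
      rw [Set.piecewise_eq_of_notMem _ _ _ hω, hgA ω hω]
      ring
    · have h1 : ∫ ω in A, (1 / 2 * g ω + 1 / 2 * A.piecewise k g ω) ∂μ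
          = ∫ ω in A, (1 / 2 * g ω + 1 / 2 * k ω) ∂μ := by
        refine setIntegral_congr_fun hA fun ω hω => ?_
        simp only [Set.piecewise_eq_of_mem _ _ _ hω]
      have hkg : ∫ ω in A, k ω ∂μ = ∫ ω in A, g ω ∂μ :=
        (IdentDistrib.mk hk.aemeasurable hg.aemeasurable hkmap).integral_eq
      rw [h1, integral_add, integral_const_mul, integral_const_mul, hkg, hgi]
      · ring
      · exact (Integrable.of_mem_Icc a b hg.aemeasurable hgb).const_mul _
      · exact (Integrable.of_mem_Icc a b hk.aemeasurable hkb').const_mul _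
    · filter_upwards [hkb, ae_restrict_mem hA] with ω hω hωA
      rw [Set.piecewise_eq_of_mem _ _ _ hωA]
      constructor <;> linarith [hω.1, hω.2]

/-- Averaging over one set preserves the class. -/
theorem LawInvariantClass.average_on [∀ (s : Set Ω) ω, Decidable (ω ∈ s)]
    (hP : LawInvariantClass μ P) (hμ : ProperlySplitting μ) {f : Ω → ℝ} (hPf : P f)
    (hf : Measurable f) {M : ℝ} (hM : ∀ᵐ ω ∂μ, |f ω| ≤ M) {A : Set Ω} (hA : MeasurableSet A) :
    P (A.piecewise (fun _ => ⨍ x in A, f x ∂μ) f) := by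
  have hm : Measurable (A.piecewise (fun _ => ⨍ x in A, f x ∂μ) f) :=
    Measurable.piecewise hA measurable_const hf
  have hM0 : 0 ≤ M := by
    obtain ⟨ω, hω⟩ := hM.exists
    exact (abs_nonneg _).trans hω
  by_cases hA0 : μ A = 0
  · refine hP.congr hPf hf hm ?_
    filter_upwards [measure_eq_zero_iff_ae_notMem.1 hA0] with ω hω
    exact Set.piecewise_eq_of_notMem _ _ _ hω
  refine hP.closed _ hm fun ε hε => ?_
  obtain ⟨n, hn⟩ := exists_pow_lt_of_lt_one (show 0 < ε / (2 * M + 1) by positivity)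
    (show (1 / 2 : ℝ) < 1 by norm_num)
  obtain ⟨g, hPg, hg, hgA, hgi, a, b, hab, hba, hgb⟩ :=
    hP.exists_small_range hμ hPf hf hM0 hM hA n
  have hle : b - a ≤ ε := by
    rw [lt_div_iff₀ (by positivity)] at hn
    rw [hba]
    have h1 : 2 * M / 2 ^ n = (1 / 2) ^ n * (2 * M) := by
      rw [one_div, inv_pow]; field_simp
    have h2 : (0 : ℝ) < (1 / 2) ^ n := by positivity
    rw [h1]
    nlinarith
  have havg : (⨍ x in A, f x ∂μ) ∈ Set.Icc a b := by
    have : (⨍ x in A, f x ∂μ) = ⨍ x in A, g x ∂μ := by rw [setAverage_eq, setAverage_eq, hgi]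
    rw [this]
    exact setAverage_mem_Icc hA0 (Integrable.of_mem_Icc a b hg.aemeasurable hgb) hgb
  refine ⟨g, hPg, ?_⟩
  filter_upwards [(ae_restrict_iff' hA).1 hgb] with ω hω
  by_cases h : ω ∈ A
  · rw [Set.piecewise_eq_of_mem _ _ _ h, abs_le]
    constructor <;> linarith [havg.1, havg.2, (hω h).1, (hω h).2]
  · rw [Set.piecewise_eq_of_notMem _ _ _ h, hgA ω h]
    simpa using hε.le

variable {ι : Type*} [Fintype ι] [MeasurableSpace ι] [DiscreteMeasurableSpace ι]

/-- The conditional expectation given a finite partition preserves the class. -/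
theorem LawInvariantClass.average_partition (hP : LawInvariantClass μ P)
    (hμ : ProperlySplitting μ) {f : Ω → ℝ} (hPf : P f) (hf : Measurable f) {M : ℝ}
    (hM : ∀ᵐ ω ∂μ, |f ω| ≤ M) {J : Ω → ι} (hJ : Measurable J) :
    P fun ω => ⨍ x in J ⁻¹' {J ω}, f x ∂μ := by
  classical
  let m : ι → ℝ := fun i => ⨍ x in J ⁻¹' {i}, f x ∂μ
  suffices h : ∀ s : Finset ι, (P fun ω => if J ω ∈ s then m (J ω) else f ω) ∧
      Measurable fun ω => if J ω ∈ s then m (J ω) else f ω by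
    simpa using (h Finset.univ).1
  intro s
  induction s using Finset.induction_on with
  | empty => simpa using ⟨hPf, hf⟩
  | insert i s hi ih =>
    obtain ⟨ihP, ihm⟩ := ih
    have hA : MeasurableSet (J ⁻¹' {i}) := hJ (measurableSet_singleton i)
    have havg : (⨍ x in J ⁻¹' {i}, (if J x ∈ s then m (J x) else f x) ∂μ) = m i := by
      simp only [m, setAverage_eq]
      congr 1
      refine setIntegral_congr_fun hA fun x hx => ?_
      have : J x = i := hx
      simp [this, hi]
    have hfun : (fun ω => if J ω ∈ insert i s then m (J ω) else f ω) =
        (J ⁻¹' {i}).piecewise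
          (fun _ => ⨍ x in J ⁻¹' {i}, (if J x ∈ s then m (J x) else f x) ∂μ)
          (fun ω => if J ω ∈ s then m (J ω) else f ω) := by
      rw [havg]
      ext ω
      by_cases h : J ω = i <;> simp [Set.piecewise, h]
    have hbd : ∀ᵐ ω ∂μ, |if J ω ∈ s then m (J ω) else f ω| ≤ M + ∑ i, |m i| := by
      filter_upwards [hM] with ω hω
      have h1 : |m (J ω)| ≤ ∑ i, |m i| :=
        Finset.single_le_sum (f := fun i => |m i|) (fun _ _ => abs_nonneg _) (Finset.mem_univ _)
      have h2 := abs_nonneg (m (J ω))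
      have h3 := abs_nonneg (f ω)
      split_ifs <;> linarith
    rw [hfun]
    exact ⟨hP.average_on hμ ihP ihm hbd hA, Measurable.piecewise hA measurable_const ihm⟩

end LawInvariantClass

section ConcaveDomination

theorem Finset.sum_sub_mul_nonneg_of_upper_sums_nonneg (T : Finset ℝ) (w : ℝ → ℝ)
    (h : ∀ t ∈ T, 0 ≤ ∑ s ∈ T with t ≤ s, w s) {m : ℝ} (hm : ∀ s ∈ T, m ≤ s) :
    0 ≤ ∑ s ∈ T, (s - m) * w s := by
  induction T using Finset.induction_on_min generalizing m with
  | empty => simp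
  | insert a S ha ih =>
    have haS : a ∉ S := fun h => lt_irrefl _ (ha a h)
    have htotal : 0 ≤ w a + ∑ s ∈ S, w s := by
      have := h a (Finset.mem_insert_self a S)
      rwa [Finset.filter_true_of_mem, Finset.sum_insert haS] at this
      intro s hs
      rcases Finset.mem_insert.1 hs with rfl | hs
      · exact le_rfl
      · exact (ha s hs).le
    have hS : 0 ≤ ∑ s ∈ S, (s - a) * w s := by
      refine ih (fun t ht => ?_) fun s hs => (ha s hs).le
      have := h t (Finset.mem_insert_of_mem ht)
      rwa [Finset.filter_insert, if_neg (not_le.2 (ha t ht))] at this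
    have hsplit : ∑ s ∈ S, (s - m) * w s
        = ∑ s ∈ S, (s - a) * w s + (a - m) * ∑ s ∈ S, w s := by
      rw [Finset.mul_sum, ← Finset.sum_add_distrib]
      exact Finset.sum_congr rfl fun s _ => by ring
    rw [Finset.sum_insert haS, hsplit]
    nlinarith [mul_nonneg (sub_nonneg.2 (hm a (Finset.mem_insert_self a S))) htotal]

/-- Summation by parts: a weight with zero total and nonnegative upper sums along `α` pairs
nonnegatively with `α`. -/
theorem sum_mul_nonneg_of_upper_sums_nonneg {ι : Type*} [Fintype ι] (α w : ι → ℝ)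
    (h0 : ∑ j, w j = 0) (h : ∀ t, 0 ≤ ∑ j with t ≤ α j, w j) : 0 ≤ ∑ j, α j * w j := by
  classical
  let T := Finset.univ.image α
  let W : ℝ → ℝ := fun s => ∑ j with α j = s, w j
  have hT : ∀ j ∈ (Finset.univ : Finset ι), α j ∈ T := fun j hj => Finset.mem_image_of_mem α hj
  obtain ⟨m, hm⟩ : ∃ m, ∀ s ∈ T, m ≤ s := T.bddBelow
  have hW : ∀ t ∈ T, 0 ≤ ∑ s ∈ T with t ≤ s, W s := by
    intro t _
    refine (h t).trans_eq ?_
    rw [← Finset.sum_fiberwise_of_maps_to (s := Finset.univ.filter fun j => t ≤ α j)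
      (t := T.filter fun s => t ≤ s) (g := α)]
    · refine Finset.sum_congr rfl fun s hs => ?_
      simp only [W, Finset.filter_filter]
      refine Finset.sum_congr (Finset.filter_congr fun j _ => ?_) fun _ _ => rfl
      have := (Finset.mem_filter.1 hs).2
      constructor
      · exact fun h => h.2
      · exact fun h => ⟨h ▸ this, h⟩
    · intro j hj
      exact Finset.mem_filter.2 ⟨hT j (Finset.mem_univ j), (Finset.mem_filter.1 hj).2⟩
  have key := T.sum_sub_mul_nonneg_of_upper_sums_nonneg W hW hm
  have h1 : ∑ s ∈ T, (s - m) * W s = ∑ j, (α j - m) * w j := by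
    rw [← Finset.sum_fiberwise_of_maps_to hT]
    refine Finset.sum_congr rfl fun s _ => ?_
    rw [Finset.mul_sum]
    exact Finset.sum_congr rfl fun j hj => by rw [(Finset.mem_filter.1 hj).2]
  rw [h1] at key
  simpa [sub_mul, Finset.sum_sub_distrib, ← Finset.mul_sum, h0] using key

variable {Ω : Type*} [MeasurableSpace Ω] {μ : Measure Ω}

variable {P : (Ω → ℝ) → Prop} {ι : Type*}

theorem LawInvariantClass.convex_setOf_comp (hP : LawInvariantClass μ P) (J : Ω → ι) :
    Convex ℝ {v : ι → ℝ | P fun ω => v (J ω)} :=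
  fun _ hu _ hv a b ha hb hab => hP.convex _ _ hu hv a b ha hb hab

variable [Fintype ι] [MeasurableSpace ι] [DiscreteMeasurableSpace ι]

theorem setIntegral_preimage_finset {J : Ω → ι} (hJ : Measurable J) {g : Ω → ℝ}
    (hg : Integrable g μ) (s : Finset ι) :
    ∫ ω in J ⁻¹' s, g ω ∂μ = ∑ j ∈ s, ∫ ω in J ⁻¹' {j}, g ω ∂μ := by
  rw [← integral_biUnion_finset s (fun j _ => hJ (measurableSet_singleton j)) ?_
    fun _ _ => hg.integrableOn]
  · congr 2
    ext ω
    simp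
  · intro i _ j _ hij
    exact Disjoint.preimage _ (by simpa using hij)

theorem LawInvariantClass.isClosed_setOf_comp (hP : LawInvariantClass μ P) {J : Ω → ι}
    (hJ : Measurable J) : IsClosed {v : ι → ℝ | P fun ω => v (J ω)} := by
  refine isClosed_of_closure_subset fun v hv => ?_
  refine hP.closed _ ((measurable_of_finite v).comp hJ) fun ε hε => ?_
  obtain ⟨u, hu, huv⟩ := Metric.mem_closure_iff.1 hv ε hε
  exact ⟨_, hu, ae_of_all _ fun ω => by
    simpa [Real.dist_eq] using (dist_le_pi_dist v u (J ω)).trans huv.le⟩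

variable [IsProbabilityMeasure μ]

/-- A rearrangement `g` of a function dominating `z` in the stop-loss order has the larger
integral over every upper level set of `g`. -/
theorem setIntegral_le_of_threshold {f g z : Ω → ℝ} (hf : AEMeasurable f μ)
    (hg : Integrable g μ) (hz : Integrable z μ) (hmap : μ.map g = μ.map f)
    (hord : ∀ c, ∫ ω, max (z ω - c) 0 ∂μ ≤ ∫ ω, max (f ω - c) 0 ∂μ)
    {E : Set Ω} (hE : MeasurableSet E) {c : ℝ}
    (hc : ∀ᵐ ω ∂μ, (ω ∉ E → g ω ≤ c) ∧ (ω ∈ E → c ≤ g ω)) :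
    ∫ ω in E, z ω ∂μ ≤ ∫ ω in E, g ω ∂μ := by
  have hzc : Integrable (fun ω => z ω - c) μ := hz.sub (integrable_const c)
  have h1 : ∫ ω in E, (z ω - c) ∂μ ≤ ∫ ω in E, max (z ω - c) 0 ∂μ :=
    setIntegral_mono hzc.integrableOn hzc.pos_part.integrableOn fun ω => le_max_left _ _
  have h2 : ∫ ω in E, max (z ω - c) 0 ∂μ ≤ ∫ ω, max (z ω - c) 0 ∂μ :=
    setIntegral_le_integral hzc.pos_part (ae_of_all _ fun ω => le_max_right _ _)
  have h3 : ∫ ω, max (f ω - c) 0 ∂μ = ∫ ω, max (g ω - c) 0 ∂μ :=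
    ((IdentDistrib.mk hg.aemeasurable hf hmap).comp
      (u := fun x => max (x - c) 0) (by fun_prop)).integral_eq.symm
  have h4 : ∫ ω, max (g ω - c) 0 ∂μ = ∫ ω in E, (g ω - c) ∂μ := by
    rw [← integral_indicator hE]
    refine integral_congr_ae ?_
    filter_upwards [hc] with ω hω
    by_cases h : ω ∈ E
    · simp [h, hω.2 h]
    · simp [h, hω.1 h]
  have h5 := h1.trans (h2.trans ((hord c).trans (h3.trans h4).le))
  rw [integral_sub hz.integrableOn (integrable_const c),
    integral_sub hg.integrableOn (integrable_const c)] at h5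
  linarith

/-- If `z` is dominated by an element of the class in the convex order, then all averages of `z`
over finite partitions belong to the class. -/
theorem LawInvariantClass.average_partition_of_dominated (hP : LawInvariantClass μ P)
    (hμ : ProperlySplitting μ) {f z : Ω → ℝ} (hPf : P f) (hf : Measurable f) {M : ℝ}
    (hM : ∀ᵐ ω ∂μ, |f ω| ≤ M) (hz : Integrable z μ)
    (hord : ∀ c, ∫ ω, max (z ω - c) 0 ∂μ ≤ ∫ ω, max (f ω - c) 0 ∂μ)
    (hint : ∫ ω, f ω ∂μ = ∫ ω, z ω ∂μ) {J : Ω → ι} (hJ : Measurable J) :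
    P fun ω => ⨍ x in J ⁻¹' {J ω}, z x ∂μ := by
  classical
  let K : Set (ι → ℝ) := {v | P fun ω => v (J ω)}
  let b : ι → ℝ := fun j => ⨍ x in J ⁻¹' {j}, z x ∂μ
  by_contra hb
  obtain ⟨l, u, hlK, hlb⟩ := geometric_hahn_banach_closed_point (x := b) (s := K)
    (hP.convex_setOf_comp J) (hP.isClosed_setOf_comp hJ) hb
  have hl : ∀ v : ι → ℝ, l v = ∑ j, v j * l (Pi.single j 1) := fun v => by
    conv_lhs => rw [pi_eq_sum_univ' v, map_sum]
    exact Finset.sum_congr rfl fun j _ => by rw [map_smul, smul_eq_mul]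
  let p : ι → ℝ := fun j => μ.real (J ⁻¹' {j})
  let α : ι → ℝ := fun j => l (Pi.single j 1) / p j
  have hα : Measurable fun ω => α (J ω) := (measurable_of_finite α).comp hJ
  obtain ⟨g, hg, hgmap, hgc⟩ := exists_map_eq_comonotone hμ hα (μ.map f)
    (by rw [Measure.map_apply hf MeasurableSet.univ, Set.preimage_univ])
    (show -M ≤ M by
      obtain ⟨ω, hω⟩ := hM.exists
      linarith [(abs_nonneg _).trans hω])
    ((ae_map_iff hf.aemeasurable measurableSet_Icc).2 (hM.mono fun ω hω => abs_le.1 hω))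
  have hgM : ∀ᵐ ω ∂μ, |g ω| ≤ M := by
    filter_upwards [ae_mem_Icc_of_map_eq hf hg hgmap.symm (hM.mono fun ω hω => abs_le.1 hω)]
      with ω hω using abs_le.2 hω
  have hgi : Integrable g μ := integrable_of_ae_abs_le hg hgM
  have hdiff : Integrable (fun ω => g ω - z ω) μ := hgi.sub hz
  let w : ι → ℝ := fun j => ∫ ω in J ⁻¹' {j}, (g ω - z ω) ∂μ
  have hw : ∀ s : Finset ι, ∑ j ∈ s, w j = ∫ ω in J ⁻¹' s, (g ω - z ω) ∂μ := fun s =>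
    (setIntegral_preimage_finset hJ hdiff s).symm
  have hnonneg : 0 ≤ ∑ j, α j * w j := by
    refine sum_mul_nonneg_of_upper_sums_nonneg α w ?_ fun t => ?_
    · rw [hw, Finset.coe_univ, Set.preimage_univ, setIntegral_univ, integral_sub hgi hz, ← hint,
        (IdentDistrib.mk hg.aemeasurable hf.aemeasurable hgmap).integral_eq, sub_self]
    · obtain ⟨c, hc⟩ := hgc t
      rw [hw, integral_sub hgi.integrableOn hz.integrableOn, sub_nonneg]
      refine setIntegral_le_of_threshold hf.aemeasurable hgi hz hgmap hord
        (hJ (Set.toFinite _).measurableSet) (c := c) ?_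
      filter_upwards [hc] with ω hω
      simpa using hω
  let v : ι → ℝ := fun j => if p j = 0 then b j else ⨍ x in J ⁻¹' {j}, g x ∂μ
  have hvK : v ∈ K := by
    refine hP.congr (hP.average_partition hμ (hP.law _ _ hPf hf hg hgmap) hg hgM hJ)
      ((measurable_of_finite fun j => ⨍ x in J ⁻¹' {j}, g x ∂μ).comp hJ)
      ((measurable_of_finite v).comp hJ) ?_
    have hnull : ∀ᵐ ω ∂μ, ∀ j, p j = 0 → J ω ≠ j :=
      ae_all_iff.2 fun j => by
        by_cases hj : p j = 0
        · filter_upwards [measure_eq_zero_iff_ae_notMem.1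
            ((measureReal_eq_zero_iff (measure_ne_top _ _)).1 hj)] with ω hω _
          exact hω
        · exact ae_of_all _ fun ω h => absurd h hj
    filter_upwards [hnull] with ω hω
    have : p (J ω) ≠ 0 := fun h => hω _ h rfl
    simp [v, this]
  have hlv : l v - l b = ∑ j, α j * w j := by
    rw [hl v, hl b, ← Finset.sum_sub_distrib]
    refine Finset.sum_congr rfl fun j _ => ?_
    by_cases hj : p j = 0
    · simp [v, hj, α]
    · simp only [v, if_neg hj, b, w, α, setAverage_eq,
        integral_sub hgi.integrableOn hz.integrableOn, smul_eq_mul]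
      change (p j)⁻¹ * _ * _ - (p j)⁻¹ * _ * _ = _
      field_simp
  linarith [hlK v hvK]

/-- A class that is convex, law-invariant and closed is stable under contractions in the
convex order. -/
theorem LawInvariantClass.mem_of_dominated (hP : LawInvariantClass μ P)
    (hμ : ProperlySplitting μ) {f z : Ω → ℝ} (hPf : P f) (hf : Measurable f) (hz : Measurable z)
    {M : ℝ} (hfM : ∀ᵐ ω ∂μ, |f ω| ≤ M) (hzM : ∀ᵐ ω ∂μ, |z ω| ≤ M)
    (hord : ∀ c, ∫ ω, max (z ω - c) 0 ∂μ ≤ ∫ ω, max (f ω - c) 0 ∂μ)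
    (hint : ∫ ω, f ω ∂μ = ∫ ω, z ω ∂μ) : P z := by
  have hzi : Integrable z μ := integrable_of_ae_abs_le hz hzM
  refine hP.closed z hz fun ε hε => ?_
  obtain ⟨N, hN⟩ := exists_nat_ge (2 * M / ε)
  let J : Ω → Fin (N + 1) := fun ω =>
    ⟨min ⌊(z ω + M) / ε⌋₊ N, Nat.lt_succ_of_le (min_le_right _ _)⟩
  have hJ : Measurable J :=
    (measurable_of_finite fun n : Fin (N + 1) => n).comp <|
      (measurable_from_nat (f := fun n : ℕ =>
        (⟨min n N, Nat.lt_succ_of_le (min_le_right _ _)⟩ : Fin (N + 1)))).comp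
        (Nat.measurable_floor.comp ((hz.add_const M).div_const ε))
  refine ⟨_, hP.average_partition_of_dominated hμ hPf hf hfM hzi hord hint hJ, ?_⟩
  have hrange : ∀ᵐ ω ∂μ, (J ω : ℝ) * ε - M ≤ z ω ∧ z ω ≤ ((J ω : ℝ) + 1) * ε - M := by
    filter_upwards [hzM] with ω hω
    obtain ⟨h1, h2⟩ := abs_le.1 hω
    have h0 : 0 ≤ (z ω + M) / ε := div_nonneg (by linarith) hε.le
    have hle : ⌊(z ω + M) / ε⌋₊ ≤ N := by
      refine Nat.floor_le_of_le (le_trans ?_ hN)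
      gcongr
      linarith
    have hval : ((J ω : ℕ) : ℝ) = (⌊(z ω + M) / ε⌋₊ : ℝ) := by simp [J, min_eq_left hle]
    have h3 := Nat.floor_le h0
    have h4 := (Nat.lt_floor_add_one ((z ω + M) / ε)).le
    rw [le_div_iff₀ hε] at h3
    rw [div_le_iff₀ hε] at h4
    rw [hval]
    constructor <;> linarith
  have havg : ∀ᵐ ω ∂μ, ∀ j, J ω = j →
      (⨍ x in J ⁻¹' {j}, z x ∂μ) ∈ Set.Icc ((j : ℝ) * ε - M) (((j : ℝ) + 1) * ε - M) := by
    refine ae_all_iff.2 fun j => ?_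
    by_cases hj : μ (J ⁻¹' {j}) = 0
    · filter_upwards [measure_eq_zero_iff_ae_notMem.1 hj] with ω hω h
      exact absurd h hω
    · refine ae_of_all _ fun ω _ => setAverage_mem_Icc hj hzi.integrableOn ?_
      filter_upwards [ae_restrict_of_ae hrange,
        ae_restrict_mem (hJ (measurableSet_singleton j))] with x hx hxj
      rwa [show J x = j from hxj] at hx
  filter_upwards [hrange, havg] with ω h1 h2
  obtain ⟨h3, h4⟩ := h2 _ rfl
  rw [abs_le]
  constructor <;> linarith [h1.1, h1.2]

end ConcaveDomination

section Superlevel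

variable {Ω : Type*} [MeasurableSpace Ω] {μ : Measure Ω}

theorem SchurConcave.lawInvariant {U : Xinf μ → ℝ} (hU : SchurConcave U) : LawInvariant U := by
  have key : ∀ Z₁ Z₂ : Xinf μ, IdentDistrib (Z₁ : Ω → ℝ) (Z₂ : Ω → ℝ) μ μ → U Z₁ ≤ U Z₂ :=
    fun Z₁ Z₂ h => hU Z₁ Z₂ fun φ hφ =>
      (h.comp (continuousOn_univ.1 (hφ.continuousOn isOpen_univ)).measurable).integral_eq.le
  exact fun Z₁ Z₂ h => (key _ _ h).antisymm (key _ _ h.symm)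

theorem Xinf.ae_abs_le_norm (Z : Xinf μ) : ∀ᵐ ω ∂μ, |Z ω| ≤ ‖Z‖ := by
  filter_upwards [ae_le_eLpNormEssSup (f := Z) (μ := μ)] with ω hω
  rw [← eLpNorm_exponent_top] at hω
  simpa [Lp.norm_def] using ENNReal.toReal_mono (Lp.eLpNorm_ne_top Z) hω

variable [IsProbabilityMeasure μ]

/-- Superlevel sets of a concave, upper semicontinuous, law-invariant functional form a convex,
law-invariant and closed class. -/
theorem lawInvariantClass_superlevel {U : Xinf μ → ℝ} (hconc : ConcaveOn ℝ Set.univ U)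
    (husc : UpperSemicontinuous U) (hlaw : LawInvariant U) (r : ℝ) :
    LawInvariantClass μ fun f => ∃ h : MemLp f ⊤ μ, r ≤ U (h.toLp f) where
  convex := by
    rintro f g ⟨hf, hUf⟩ ⟨hg, hUg⟩ a b ha hb hab
    refine ⟨(hf.const_mul a).add (hg.const_mul b), ?_⟩
    have := hconc.convex_ge r ⟨Set.mem_univ _, hUf⟩ ⟨Set.mem_univ _, hUg⟩ ha hb hab
    exact this.2
  law := by
    rintro f g ⟨hf, hUf⟩ hfm hgm h
    have hid : IdentDistrib f g μ μ := ⟨hfm.aemeasurable, hgm.aemeasurable, h.symm⟩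
    have hg : MemLp g ⊤ μ := hid.memLp_snd hf
    refine ⟨hg, hUf.trans_eq (hlaw _ _ ?_)⟩
    exact ((IdentDistrib.of_ae_eq (Lp.aestronglyMeasurable _).aemeasurable hf.coeFn_toLp).trans
      hid).trans (IdentDistrib.of_ae_eq (Lp.aestronglyMeasurable _).aemeasurable
        hg.coeFn_toLp).symm
  closed := by
    intro f hf h
    have hfL : MemLp f ⊤ μ := by
      obtain ⟨g, ⟨hg, -⟩, hfg⟩ := h 1 one_pos
      have := (memLp_top_of_bound (hf.aestronglyMeasurable.sub hg.1) 1 hfg).add hg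
      simpa using this
    refine ⟨hfL, ?_⟩
    suffices hfL.toLp f ∈ closure (U ⁻¹' Set.Ici r) from
      (husc.isClosed_preimage r).closure_subset this
    refine Metric.mem_closure_iff.2 fun ε hε => ?_
    obtain ⟨g, ⟨hg, hUg⟩, hfg⟩ := h (ε / 2) (half_pos hε)
    refine ⟨hg.toLp g, hUg, ?_⟩
    rw [dist_eq_norm, ← MemLp.toLp_sub]
    have hnorm := Lp.norm_le_of_ae_bound (f := (hfL.sub hg).toLp (f - g)) (half_pos hε).le <| by
      filter_upwards [(hfL.sub hg).coeFn_toLp, hfg] with ω h1 h2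
      rw [h1]
      exact h2
    refine hnorm.trans_lt ?_
    simpa using half_lt_self hε

theorem LawInvariant.schurConcave (hμ : ProperlySplitting μ) {U : Xinf μ → ℝ}
    (hconc : ConcaveOn ℝ Set.univ U) (husc : UpperSemicontinuous U) (hlaw : LawInvariant U) :
    SchurConcave U := by
  intro Z₁ Z₂ hZ
  have hint : ∫ ω, Z₁ ω ∂μ = ∫ ω, Z₂ ω ∂μ := by
    refine (hZ id (concaveOn_id convex_univ)).antisymm ?_
    simpa [integral_neg] using hZ (-id) (convexOn_id convex_univ).neg
  have hord : ∀ c, ∫ ω, max (Z₂ ω - c) 0 ∂μ ≤ ∫ ω, max (Z₁ ω - c) 0 ∂μ := fun c => by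
    have hconv : ConvexOn ℝ Set.univ fun x : ℝ => max (x - c) 0 :=
      ((convexOn_id convex_univ).sub (concaveOn_const c convex_univ)).sup
        (convexOn_const 0 convex_univ)
    simpa [integral_neg] using hZ _ hconv.neg
  obtain ⟨h, hU⟩ := (lawInvariantClass_superlevel hconc husc hlaw (U Z₁)).mem_of_dominated hμ
    ⟨Lp.memLp Z₁, by rw [Lp.toLp_coeFn]⟩ (Lp.stronglyMeasurable Z₁).measurable
    (Lp.stronglyMeasurable Z₂).measurable (M := max ‖Z₁‖ ‖Z₂‖)
    ((Xinf.ae_abs_le_norm Z₁).mono fun ω h => h.trans (le_max_left _ _))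
    ((Xinf.ae_abs_le_norm Z₂).mono fun ω h => h.trans (le_max_right _ _)) hord hint
  rwa [Lp.toLp_coeFn] at hU

end Superlevel

/-- For a concave functional on `L^∞`, upper semicontinuous with respect to the
norm topology, Schur concavity is equivalent to law invariance. -/
theorem schurConcave_iff_lawInvariant
    (hatomless : AtomlessMeasure μ) (U : Xinf μ → ℝ)
    (hconc : ConcaveOn ℝ Set.univ U) (husc : UpperSemicontinuous U) :
    SchurConcave U ↔ LawInvariant U :=
  ⟨SchurConcave.lawInvariant, LawInvariant.schurConcave hatomless hconc husc⟩

end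
end

section
/- Suppose a functional U : 𝒳 → ℝ is monotone, concave, and upper semicontinuous with respect to the L^∞ norm topology. Then U is S.S.D. preserving if and only if it is law-invariant. -/
open MeasureTheory ProbabilityTheory Filter

noncomputable section

variable {Ω : Type*} [MeasurableSpace Ω] (μ : MeasureTheory.Measure Ω) [MeasureTheory.IsProbabilityMeasure μ]

variable {μ}

lemma AtomlessMeasure.exists_subset_le_div_two_pow (h : AtomlessMeasure μ) {s : Set Ω}
    (hs : MeasurableSet s) (h0 : 0 < μ.real s) (n : ℕ) :
    ∃ t ⊆ s, MeasurableSet t ∧ 0 < μ.real t ∧ μ.real t ≤ μ.real s / 2 ^ n := by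
  induction n with
  | zero => exact ⟨s, subset_rfl, hs, h0, by simp⟩
  | succ n ih =>
    obtain ⟨t, hts, ht, ht0, htn⟩ := ih
    obtain ⟨u, hut, hu, hu0, hult⟩ := h t ht (fun h0 => by simp [Measure.real, h0] at ht0)
    have hu0' : 0 < μ.real u := ENNReal.toReal_pos hu0.ne' (measure_ne_top _ _)
    have hult' : μ.real u < μ.real t := (ENNReal.toReal_lt_toReal (by simp) (by simp)).2 hult
    have hd : μ.real (t \ u) = μ.real t - μ.real u := measureReal_sdiff hut hu
    have hn : μ.real s / 2 ^ (n + 1) = μ.real s / 2 ^ n / 2 := by rw [pow_succ, div_div]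
    rcases le_total (μ.real u) (μ.real t / 2) with hle | hle
    · exact ⟨u, hut.trans hts, hu, hu0', by linarith⟩
    · exact ⟨t \ u, Set.sdiff_subset.trans hts, ht.diff hu, by linarith, by linarith⟩

lemma AtomlessMeasure.exists_subset_le (h : AtomlessMeasure μ) {s : Set Ω}
    (hs : MeasurableSet s) (h0 : 0 < μ.real s) {ε : ℝ} (hε : 0 < ε) :
    ∃ t ⊆ s, MeasurableSet t ∧ 0 < μ.real t ∧ μ.real t ≤ ε := by
  obtain ⟨n, hn⟩ := exists_nat_gt (μ.real s / ε)
  obtain ⟨t, hts, ht, ht0, htn⟩ := h.exists_subset_le_div_two_pow hs h0 n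
  refine ⟨t, hts, ht, ht0, htn.trans ?_⟩
  have h2 : (n : ℝ) < 2 ^ n := by exact_mod_cast Nat.lt_two_pow_self
  rw [div_le_iff₀ (by positivity)]
  rw [div_lt_iff₀ hε] at hn
  nlinarith

/-- One greedy step: among the admissible additions to `A`, take one at least half as large
as any other. -/
lemma exists_greedy_step {s A : Set Ω} {c : ℝ} (hA : μ.real A ≤ c) (hAs : A ⊆ s)
    (hAm : MeasurableSet A) :
    ∃ A' ⊆ s, MeasurableSet A' ∧ A ⊆ A' ∧ μ.real A' ≤ c ∧
      ∀ t ⊆ s, MeasurableSet t → Disjoint A t → μ.real A + μ.real t ≤ c →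
        μ.real t ≤ 2 * (μ.real A' - μ.real A) := by
  set S : Set ℝ := {x | ∃ t ⊆ s, MeasurableSet t ∧ Disjoint A t ∧ μ.real A + μ.real t ≤ c ∧
    μ.real t = x}
  have hb : BddAbove S := by
    refine ⟨1, ?_⟩
    rintro x ⟨t, -, -, -, -, rfl⟩
    exact measureReal_le_one
  by_cases h : 0 < sSup S
  · have hne : S.Nonempty := ⟨0, ∅, by simp, by simp, by simp, by simpa using hA, by simp⟩
    obtain ⟨x, ⟨t, hts, ht, hd, htc, rfl⟩, hx⟩ := exists_lt_of_lt_csSup hne (half_lt_self h)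
    have hu : μ.real (A ∪ t) = μ.real A + μ.real t := measureReal_union hd ht
    refine ⟨A ∪ t, Set.union_subset hAs hts, hAm.union ht, Set.subset_union_left, by linarith, ?_⟩
    intro t' ht's ht' hd' htc'
    have := le_csSup hb ⟨t', ht's, ht', hd', htc', rfl⟩
    linarith
  · refine ⟨A, hAs, hAm, subset_rfl, hA, ?_⟩
    intro t' ht's ht' hd' htc'
    have := le_csSup hb ⟨t', ht's, ht', hd', htc', rfl⟩
    linarith

/-- Sierpiński's theorem: an atomless measure takes all intermediate values. -/
lemma AtomlessMeasure.exists_subset_measureReal_eq (h : AtomlessMeasure μ) {s : Set Ω}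
    (hs : MeasurableSet s) {c : ℝ} (hc0 : 0 ≤ c) (hc : c ≤ μ.real s) :
    ∃ t ⊆ s, MeasurableSet t ∧ μ.real t = c := by
  choose! nx hn1 hn2 hn3 hn4 hn5 using
    fun (A : Set Ω) (hA : μ.real A ≤ c ∧ A ⊆ s ∧ MeasurableSet A) =>
      exists_greedy_step hA.1 hA.2.1 hA.2.2
  let A : ℕ → Set Ω := fun n => Nat.rec ∅ (fun _ B => nx B) n
  have hA : ∀ n, μ.real (A n) ≤ c ∧ A n ⊆ s ∧ MeasurableSet (A n) := by
    intro n
    induction n with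
    | zero => exact ⟨by simpa [A] using hc0, by simp [A], by simp [A]⟩
    | succ n ih => exact ⟨hn4 _ ih, hn1 _ ih, hn2 _ ih⟩
  have hmonoA : Monotone A := monotone_nat_of_le_succ fun n => hn3 _ (hA n)
  have hUm : MeasurableSet (⋃ n, A n) := MeasurableSet.iUnion fun n => (hA n).2.2
  have hUs : (⋃ n, A n) ⊆ s := Set.iUnion_subset fun n => (hA n).2.1
  have htend : Tendsto (fun n => μ.real (A n)) atTop (nhds (μ.real (⋃ n, A n))) :=
    (ENNReal.tendsto_toReal (measure_ne_top _ _)).comp (tendsto_measure_iUnion_atTop hmonoA)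
  have hUc : μ.real (⋃ n, A n) ≤ c := le_of_tendsto' htend fun n => (hA n).1
  refine ⟨⋃ n, A n, hUs, hUm, hUc.antisymm ?_⟩
  by_contra! hlt
  have hd : μ.real (s \ ⋃ n, A n) = μ.real s - μ.real (⋃ n, A n) := measureReal_sdiff hUs hUm
  obtain ⟨t, hts, ht, ht0, hte⟩ := h.exists_subset_le (hs.diff hUm)
    (by linarith) (sub_pos.2 hlt)
  have hstep : ∀ n, μ.real t ≤ 2 * (μ.real (A (n + 1)) - μ.real (A n)) := by
    intro n
    refine hn5 (A n) (hA n) t (hts.trans Set.sdiff_subset) ht ?_ ?_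
    · refine Set.disjoint_left.2 fun ω hω hωt => (hts hωt).2 (Set.mem_iUnion.2 ⟨n, hω⟩)
    · have : μ.real (A n) ≤ μ.real (⋃ n, A n) := measureReal_mono (Set.subset_iUnion A n)
      linarith
  have hlim := (((tendsto_add_atTop_iff_nat 1).2 htend).sub htend).const_mul 2
  have := ge_of_tendsto' hlim hstep
  simp at this
  linarith

lemma AtomlessMeasure.exists_between_measure_eq (h : AtomlessMeasure μ) {S T : Set Ω}
    (hS : MeasurableSet S) (hT : MeasurableSet T) (hST : S ⊆ T) {p : ENNReal}
    (hp : μ S ≤ p) (hp' : p ≤ μ T) :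
    ∃ A, MeasurableSet A ∧ S ⊆ A ∧ A ⊆ T ∧ μ A = p := by
  have hpt : p ≠ ⊤ := ne_top_of_le_ne_top (measure_ne_top μ T) hp'
  have h1 : μ.real S ≤ p.toReal := ENNReal.toReal_mono hpt hp
  have h2 : p.toReal ≤ μ.real T := ENNReal.toReal_mono (by simp) hp'
  obtain ⟨t, hts, ht, htc⟩ := h.exists_subset_measureReal_eq (hT.diff hS)
    (sub_nonneg.2 h1) (by rw [measureReal_sdiff hST hS]; linarith)
  refine ⟨S ∪ t, hS.union ht, Set.subset_union_left,
    Set.union_subset hST (hts.trans Set.sdiff_subset), ?_⟩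
  rw [← ENNReal.toReal_eq_toReal_iff' (by simp) hpt]
  have := measureReal_union (μ := μ) (Set.disjoint_sdiff_right.mono_right hts) ht
  simp only [Measure.real] at *
  linarith

/-- `A` is a lower set of `B` with respect to `f`. -/
def IsLowerIn (f : Ω → ℝ) (B A : Set Ω) : Prop :=
  MeasurableSet A ∧ A ⊆ B ∧ ∀ ω ∈ A, ∀ ω' ∈ B \ A, f ω ≤ f ω'

lemma IsLowerIn.exists_extension (h : AtomlessMeasure μ) {f : Ω → ℝ} (hf : Measurable f) {M : ℝ}
    (hM : ∀ ω, |f ω| ≤ M) {A B : Set Ω} (hB : MeasurableSet B) (hA : IsLowerIn f B A)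
    {p : ENNReal} (hp : μ A ≤ p) (hp' : p ≤ μ B) :
    ∃ A', IsLowerIn f B A' ∧ A ⊆ A' ∧ μ A' = p := by
  obtain ⟨hAm, hAB, hlow⟩ := hA
  rcases hp.eq_or_lt with heq | hlt
  · exact ⟨A, ⟨hAm, hAB, hlow⟩, subset_rfl, heq⟩
  let G : ℝ → Set Ω := fun z => A ∪ (B ∩ {ω | f ω ≤ z})
  have hGm : ∀ z, MeasurableSet (G z) := fun z =>
    hAm.union (hB.inter (measurableSet_le hf measurable_const))
  have hGmono : Monotone G := fun z z' hz =>
    Set.union_subset_union_right _ fun ω hω => ⟨hω.1, le_trans hω.2 hz⟩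
  let S : Set ℝ := {z | p ≤ μ (G z)}
  have hMS : M ∈ S := hp'.trans (measure_mono fun ω hω =>
    Or.inr ⟨hω, (le_abs_self _).trans (hM ω)⟩)
  have hSb : BddBelow S := by
    refine ⟨-M, fun z hz => ?_⟩
    by_contra! hzM
    have : G z = A := by
      refine Set.union_eq_self_of_subset_right fun ω hω => ?_
      have h1 := (abs_le.1 (hM ω)).1
      have h2 : f ω ≤ z := hω.2
      linarith
    have hz' : p ≤ μ (G z) := hz
    rw [this] at hz'
    exact absurd hz' (not_le.2 hlt)
  set z := sInf S
  have hupper : p ≤ μ (G z) := by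
    obtain ⟨u, hu1, hu2, hu3⟩ := exists_seq_strictAnti_tendsto z
    have hI : G z = ⋂ n, G (u n) := by
      ext ω
      simp only [G, Set.mem_iInter, Set.mem_union, Set.mem_inter_iff, Set.mem_ofPred_eq]
      refine ⟨fun hω n => hω.imp_right fun h => ⟨h.1, h.2.trans (hu2 n).le⟩, fun hω => ?_⟩
      by_cases hωA : ω ∈ A
      · exact Or.inl hωA
      · exact Or.inr ⟨((hω 0).resolve_left hωA).1,
          ge_of_tendsto' hu3 fun n => ((hω n).resolve_left hωA).2⟩
    rw [hI]
    refine ge_of_tendsto' (tendsto_measure_iInter_atTop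
      (fun n => (hGm _).nullMeasurableSet) (fun m n hmn => hGmono (hu1.antitone hmn))
      ⟨0, measure_ne_top _ _⟩) fun n => ?_
    obtain ⟨y, hy, hyu⟩ := exists_lt_of_csInf_lt ⟨M, hMS⟩ (hu2 n)
    exact le_trans (show p ≤ μ (G y) from hy) (measure_mono (hGmono hyu.le))
  have hlower : μ (A ∪ (B ∩ {ω | f ω < z})) ≤ p := by
    obtain ⟨u, hu1, hu2, hu3⟩ := exists_seq_strictMono_tendsto z
    have hU : A ∪ (B ∩ {ω | f ω < z}) = ⋃ n, G (u n) := by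
      ext ω
      simp only [G, Set.mem_iUnion, Set.mem_union, Set.mem_inter_iff, Set.mem_ofPred_eq]
      constructor
      · rintro (hω | ⟨hωB, hωz⟩)
        · exact ⟨0, Or.inl hω⟩
        · obtain ⟨n, hn⟩ := (hu3.eventually (lt_mem_nhds hωz)).exists
          exact ⟨n, Or.inr ⟨hωB, hn.le⟩⟩
      · rintro ⟨n, hω⟩
        exact hω.imp_right fun h => ⟨h.1, h.2.trans_lt (hu2 n)⟩
    rw [hU]
    refine le_of_tendsto' (tendsto_measure_iUnion_atTop
      fun m n hmn => hGmono (hu1.monotone hmn)) fun n => ?_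
    by_contra! hlt
    exact absurd (csInf_le hSb (show u n ∈ S from hlt.le)) (not_le.2 (hu2 n))
  obtain ⟨A', hA'm, hSA', hA'T, hA'p⟩ := h.exists_between_measure_eq
    (hAm.union (hB.inter (measurableSet_lt hf measurable_const))) (hGm z)
    (Set.union_subset_union_right _ fun ω hω => ⟨hω.1, le_of_lt (show f ω < z from hω.2)⟩) hlower hupper
  have hAA' : A ⊆ A' := Set.subset_union_left.trans hSA'
  refine ⟨A', ⟨hA'm, hA'T.trans (Set.union_subset hAB Set.inter_subset_left), ?_⟩, hAA', hA'p⟩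
  rintro ω hω ω' ⟨hω'B, hω'⟩
  rcases hA'T hω with hωA | hωz
  · exact hlow ω hωA ω' ⟨hω'B, fun h => hω' (hAA' h)⟩
  · refine le_trans hωz.2 (not_lt.1 fun hlt => hω' (hSA' (Or.inr ⟨hω'B, hlt⟩)))

/-- In an atomless space a bounded random variable `f` admits, on `B`, a comonotone index with any
prescribed distribution on `{0, …, K}`. -/
lemma AtomlessMeasure.exists_ordered_index (h : AtomlessMeasure μ) {f : Ω → ℝ} (hf : Measurable f)
    {M : ℝ} (hM : ∀ ω, |f ω| ≤ M) {B : Set Ω} (hB : MeasurableSet B) (K : ℕ) {p : ℕ → ENNReal}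
    (hp : Monotone p) (hpB : ∀ k, p k ≤ μ B) :
    ∃ κ : Ω → ℕ, Measurable κ ∧ (∀ ω, κ ω ≤ K) ∧
      (∀ ω ∈ B, ∀ ω' ∈ B, κ ω < κ ω' → f ω ≤ f ω') ∧
      ∀ k < K, μ (B ∩ {ω | κ ω ≤ k}) = p k := by
  choose! nx hn1 hn2 hn3 using
    fun (A : Set Ω) (q : ENNReal) (hA : IsLowerIn f B A ∧ μ A ≤ q ∧ q ≤ μ B) =>
      hA.1.exists_extension h hf hM hB hA.2.1 hA.2.2
  let C : ℕ → Set Ω := fun n => Nat.rec (nx ∅ (p 0)) (fun i D => nx D (p (i + 1))) n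
  have h0 : IsLowerIn f B ∅ ∧ μ (∅ : Set Ω) ≤ p 0 ∧ p 0 ≤ μ B :=
    ⟨⟨by simp, by simp, by simp⟩, by simp, hpB 0⟩
  have hC : ∀ n, IsLowerIn f B (C n) ∧ μ (C n) = p n := by
    intro n
    induction n with
    | zero => exact ⟨hn1 _ _ h0, hn3 _ _ h0⟩
    | succ n ih =>
      have : IsLowerIn f B (C n) ∧ μ (C n) ≤ p (n + 1) ∧ p (n + 1) ≤ μ B :=
        ⟨ih.1, ih.2.trans_le (hp n.le_succ), hpB _⟩
      exact ⟨hn1 _ _ this, hn3 _ _ this⟩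
  have hCmono : Monotone C := monotone_nat_of_le_succ fun n =>
    hn2 _ _ ⟨(hC n).1, (hC n).2.trans_le (hp n.le_succ), hpB _⟩
  let κ : Ω → ℕ := fun ω => ∑ k ∈ Finset.range K, (C k)ᶜ.indicator 1 ω
  have hκcard : ∀ ω : Ω, ∃ s : Finset ℕ, κ ω = s.card ∧ ∀ k, k ∈ s ↔ k < K ∧ ω ∉ C k := by
    intro ω
    refine ⟨@Finset.filter ℕ (fun k => ω ∉ C k) (Classical.decPred _) (Finset.range K), ?_,
      fun k => by simp⟩
    simp only [κ, Finset.card_filter]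
    refine Finset.sum_congr rfl fun k _ => ?_
    rcases Classical.em (ω ∈ C k) with hk | hk <;> simp [hk]
  have hκ : ∀ k < K, ∀ ω, κ ω ≤ k ↔ ω ∈ C k := by
    intro k hk ω
    obtain ⟨s, hs, hmem⟩ := hκcard ω
    rw [hs]
    constructor
    · intro hle
      refine not_not.1 fun hω => ?_
      have : Finset.range (k + 1) ⊆ s := by
        intro i hi
        rw [Finset.mem_range] at hi
        exact (hmem i).2 ⟨by omega, fun hi' => hω (hCmono (by omega : i ≤ k) hi')⟩
      have := Finset.card_le_card this
      rw [Finset.card_range] at this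
      omega
    · intro hω
      have : s ⊆ Finset.range k := by
        intro i hi
        rw [Finset.mem_range]
        by_contra! hki
        exact ((hmem i).1 hi).2 (hCmono hki hω)
      simpa using Finset.card_le_card this
  have hκK : ∀ ω, κ ω ≤ K := by
    intro ω
    obtain ⟨s, hs, hmem⟩ := hκcard ω
    rw [hs]
    have : s ⊆ Finset.range K := fun i hi => Finset.mem_range.2 ((hmem i).1 hi).1
    simpa using Finset.card_le_card this
  refine ⟨κ, ?_, ?_, ?_, ?_⟩
  · exact Finset.measurable_sum _ fun k _ => measurable_one.indicator (hC k).1.1.compl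
  · exact hκK
  · intro ω hω ω' hω' hlt
    have hK : κ ω < K := hlt.trans_le (hκK ω')
    exact (hC (κ ω)).1.2.2 ω ((hκ _ hK ω).1 le_rfl) ω'
      ⟨hω', fun hmem => absurd ((hκ _ hK ω').2 hmem) (not_le.2 hlt)⟩
  · intro k hk
    have : B ∩ {ω | κ ω ≤ k} = C k := by
      ext ω
      simp only [Set.mem_inter_iff, Set.mem_ofPred_eq, hκ k hk]
      exact ⟨fun h => h.2, fun h => ⟨(hC k).1.2.1 h, h⟩⟩
    rw [this, (hC k).2]

/-- Everywhere bounded measurable functions. -/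
def boundedMeasurable (Ω : Type*) [MeasurableSpace Ω] : Set (Ω → ℝ) :=
  {f | Measurable f ∧ ∃ M, ∀ ω, |f ω| ≤ M}

lemma indicator_add_indicator_compl_mem_boundedMeasurable {A : Set Ω} (hA : MeasurableSet A)
    {f g : Ω → ℝ} (hf : f ∈ boundedMeasurable Ω) (hg : g ∈ boundedMeasurable Ω) :
    A.indicator f + Aᶜ.indicator g ∈ boundedMeasurable Ω := by
  obtain ⟨hfm, M, hM⟩ := hf
  obtain ⟨hgm, N, hN⟩ := hg
  refine ⟨(hfm.indicator hA).add (hgm.indicator hA.compl), max M N, fun ω => ?_⟩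
  by_cases hω : ω ∈ A
  · simpa [hω] using Or.inl (hM ω)
  · simpa [hω] using Or.inr (hN ω)

lemma const_mem_boundedMeasurable (c : ℝ) : (fun _ => c) ∈ boundedMeasurable Ω :=
  ⟨measurable_const, |c|, fun _ => le_rfl⟩

lemma integrable_of_mem_boundedMeasurable {f : Ω → ℝ} (hf : f ∈ boundedMeasurable Ω) :
    Integrable f μ := by
  obtain ⟨hfm, M, hM⟩ := hf
  exact Integrable.of_bound hfm.aestronglyMeasurable M (Eventually.of_forall hM)

lemma comp_nat_mem_boundedMeasurable {κ : Ω → ℕ} (hκ : Measurable κ) {K : ℕ}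
    (hK : ∀ ω, κ ω ≤ K) (y : ℕ → ℝ) : y ∘ κ ∈ boundedMeasurable Ω := by
  refine ⟨(measurable_from_nat).comp hκ, ∑ k ∈ Finset.range (K + 1), |y k|, fun ω => ?_⟩
  exact Finset.single_le_sum (f := fun k => |y k|) (fun _ _ => abs_nonneg _)
    (Finset.mem_range.2 (Nat.lt_succ_of_le (hK ω)))

/-- A monotone, concave, law-invariant functional on bounded measurable functions, upper
semicontinuous in the direction of the constants. -/
structure IsLawInvariantUtility (μ : Measure Ω) (V : (Ω → ℝ) → ℝ) : Prop where
  mono : ∀ f ∈ boundedMeasurable Ω, ∀ g ∈ boundedMeasurable Ω, f ≤ᵐ[μ] g → V f ≤ V g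
  conc : ConcaveOn ℝ (boundedMeasurable Ω) V
  law : ∀ f ∈ boundedMeasurable Ω, ∀ g ∈ boundedMeasurable Ω, μ.map f = μ.map g → V f = V g
  usc : ∀ f ∈ boundedMeasurable Ω, ∀ ε > 0, ∃ δ > 0, V (fun ω => f ω + δ) ≤ V f + ε

lemma map_indicator_add_congr {ν : Measure Ω} {A : Set Ω} (hA : MeasurableSet A) {f g h : Ω → ℝ}
    (hf : Measurable f) (hg : Measurable g) (hh : Measurable h)
    (hfg : (ν.restrict A).map f = (ν.restrict A).map g) :
    ν.map (A.indicator f + Aᶜ.indicator h) = ν.map (A.indicator g + Aᶜ.indicator h) := by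
  have key : ∀ f' : Ω → ℝ, Measurable f' → ν.map (A.indicator f' + Aᶜ.indicator h) =
      (ν.restrict A).map f' + (ν.restrict Aᶜ).map h := by
    intro f' hf'
    have hm : Measurable (A.indicator f' + Aᶜ.indicator h) :=
      (hf'.indicator hA).add (hh.indicator hA.compl)
    conv_lhs => rw [← Measure.restrict_add_restrict_compl (μ := ν) hA]
    rw [Measure.map_add _ _ hm]
    congr 1
    · refine Measure.map_congr ?_
      filter_upwards [ae_restrict_mem hA] with ω hω
      simp [hω]
    · refine Measure.map_congr ?_
      filter_upwards [ae_restrict_mem hA.compl] with ω hω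
      have : ω ∉ A := hω
      simp [this]
  rw [key f hf, key g hg, hfg]

/-- Averaging the rotations of a function which is constant on equiprobable cells of `A`. -/
lemma IsLawInvariantUtility.le_rotation_average {V : (Ω → ℝ) → ℝ}
    (hV : IsLawInvariantUtility μ V) {A : Set Ω} (hA : MeasurableSet A) {N : ℕ} [NeZero N]
    {κ : Ω → Fin N} (hκ : Measurable κ) {c : ENNReal} (hc : ∀ k, μ (κ ⁻¹' {k} ∩ A) = c)
    (u : Fin N → ℝ) {f : Ω → ℝ} (hf : f ∈ boundedMeasurable Ω) :
    V (A.indicator (u ∘ κ) + Aᶜ.indicator f) ≤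
      V (A.indicator (fun _ => (∑ k, u k) / N) + Aᶜ.indicator f) := by
  have hN : (N : ℝ) ≠ 0 := Nat.cast_ne_zero.2 (NeZero.ne N)
  let g : Fin N → Ω → ℝ := fun j ω => u (κ ω + j)
  have hgm : ∀ j, Measurable (g j) := fun j =>
    (measurable_of_countable (fun k : Fin N => u (k + j))).comp hκ
  have hgb : ∀ j, g j ∈ boundedMeasurable Ω := fun j =>
    ⟨hgm j, ∑ k, |u k|, fun ω => Finset.single_le_sum (f := fun k => |u k|)
      (fun _ _ => abs_nonneg _) (Finset.mem_univ _)⟩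
  have hB : ∀ j, A.indicator (g j) + Aᶜ.indicator f ∈ boundedMeasurable Ω := fun j =>
    indicator_add_indicator_compl_mem_boundedMeasurable hA (hgb j) hf
  have hg0 : g 0 = u ∘ κ := by
    ext ω
    simp [g]
  have hlaw : ∀ j, V (A.indicator (g j) + Aᶜ.indicator f) =
      V (A.indicator (u ∘ κ) + Aᶜ.indicator f) := by
    intro j
    rw [← hg0]
    refine hV.law _ (hB j) _ (hB 0) (map_indicator_add_congr hA (hgm j) (hgm 0) hf.1 ?_)
    have hκj : ∀ j, Measurable fun ω => κ ω + j := fun j =>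
      (measurable_of_countable (fun k : Fin N => k + j)).comp hκ
    have hm : ∀ j, (μ.restrict A).map (g j) = ((μ.restrict A).map fun ω => κ ω + j).map u :=
      fun j => (Measure.map_map (measurable_of_countable u) (hκj j)).symm
    rw [hm, hm]
    congr 1
    refine Measure.ext_of_singleton fun k => ?_
    have hs : ∀ j, ((μ.restrict A).map fun ω => κ ω + j) {k} = c := by
      intro j
      rw [Measure.map_apply (hκj j) (measurableSet_singleton k),
        Measure.restrict_apply ((hκj j) (measurableSet_singleton k)), ← hc (k - j)]
      congr 2
      ext ω
      simp [eq_sub_iff_add_eq]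
    rw [hs, hs]
  have hsum := hV.conc.le_map_sum (t := Finset.univ) (w := fun _ : Fin N => (N : ℝ)⁻¹)
    (p := fun j => A.indicator (g j) + Aᶜ.indicator f) (fun _ _ => by positivity)
    (by simp [hN]) (fun j _ => hB j)
  simp only [hlaw] at hsum
  have hL : ∑ _j : Fin N, (N : ℝ)⁻¹ • V (A.indicator (u ∘ κ) + Aᶜ.indicator f) =
      V (A.indicator (u ∘ κ) + Aᶜ.indicator f) := by
    rw [Finset.sum_const, Finset.card_univ, Fintype.card_fin, nsmul_eq_mul, smul_eq_mul,
      mul_inv_cancel_left₀ hN]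
  have hR : ∑ j : Fin N, (N : ℝ)⁻¹ • (A.indicator (g j) + Aᶜ.indicator f) =
      A.indicator (fun _ => (∑ k, u k) / N) + Aᶜ.indicator f := by
    ext ω
    rw [Finset.sum_apply]
    by_cases hω : ω ∈ A
    · simp only [Pi.smul_apply, Pi.add_apply, Set.indicator_of_mem hω, smul_eq_mul,
        Set.indicator_of_notMem (Set.notMem_compl_iff.2 hω), add_zero, ← Finset.mul_sum, g]
      rw [Fintype.sum_equiv (Equiv.addLeft (κ ω)) (fun j => u (κ ω + j)) u fun j => rfl]
      ring
    · simp [hω, hN]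
  rwa [hL, hR] at hsum

lemma setIntegral_comp_nat {κ : Ω → ℕ} (hκ : Measurable κ) {N : ℕ} (hN : ∀ ω, κ ω < N)
    (A : Set Ω) (y : ℕ → ℝ) :
    ∫ ω in A, y (κ ω) ∂μ = ∑ k ∈ Finset.range N, y k * μ.real (A ∩ κ ⁻¹' {k}) := by
  have hm : ∀ k, MeasurableSet (κ ⁻¹' {k}) := fun k => hκ (measurableSet_singleton k)
  have h1 : ∀ ω, y (κ ω) = ∑ k ∈ Finset.range N, (κ ⁻¹' {k}).indicator (fun _ => y k) ω := by
    intro ω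
    rw [Finset.sum_eq_single (κ ω)]
    · simp
    · intro k _ hk
      simp [hk.symm]
    · intro h
      exact absurd (Finset.mem_range.2 (hN ω)) h
  simp_rw [h1]
  rw [integral_finsetSum _ fun k _ => (integrable_const _).indicator (hm k)]
  refine Finset.sum_congr rfl fun k _ => ?_
  rw [integral_indicator (hm k), Measure.restrict_restrict (hm k), setIntegral_const,
    smul_eq_mul, mul_comm, Set.inter_comm]

lemma AtomlessMeasure.exists_ordered_equipartition (h : AtomlessMeasure μ) {f : Ω → ℝ}
    (hf : Measurable f) {M : ℝ} (hM : ∀ ω, |f ω| ≤ M) {A : Set Ω} (hA : MeasurableSet A)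
    {N : ℕ} (hN : 0 < N) :
    ∃ κ : Ω → ℕ, Measurable κ ∧ (∀ ω, κ ω < N) ∧
      (∀ ω ∈ A, ∀ ω' ∈ A, κ ω < κ ω' → f ω ≤ f ω') ∧
      ∀ k < N, μ.real (A ∩ κ ⁻¹' {k}) = μ.real A / N := by
  have hN' : (0 : ℝ) < N := by exact_mod_cast hN
  obtain ⟨κ, hκ, hκN, hord, hp⟩ := h.exists_ordered_index hf hM hA (N - 1)
    (p := fun k => ENNReal.ofReal (min 1 ((k + 1 : ℝ) / N) * μ.real A))
    (fun i j hij => by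
      have : (i : ℝ) ≤ j := by exact_mod_cast hij
      dsimp only
      gcongr)
    (fun k => by
      refine (ENNReal.ofReal_le_ofReal (mul_le_of_le_one_left measureReal_nonneg
        (min_le_left _ _))).trans ?_
      simp [Measure.real])
  have hκlt : ∀ ω, κ ω < N := fun ω => by
    have := hκN ω
    omega
  have hcum : ∀ k < N, μ.real (A ∩ {ω | κ ω ≤ k}) = (k + 1 : ℝ) / N * μ.real A := by
    intro k hk
    rcases Nat.lt_or_ge k (N - 1) with hk' | hk'
    · have hle : (k + 1 : ℝ) / N ≤ 1 := by
        rw [div_le_one hN']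
        exact_mod_cast hk
      rw [Measure.real, hp k hk', min_eq_right hle, ENNReal.toReal_ofReal (by positivity)]
    · have hset : A ∩ {ω | κ ω ≤ k} = A :=
        Set.inter_eq_left.2 fun ω _ => (hκN ω).trans hk'
      have : (k + 1 : ℝ) = N := by
        have : k + 1 = N := by omega
        exact_mod_cast this
      rw [hset, this, div_self hN'.ne', one_mul]
  refine ⟨κ, hκ, hκlt, hord, fun k hk => ?_⟩
  cases k with
  | zero =>
    have hset : A ∩ κ ⁻¹' {0} = A ∩ {ω | κ ω ≤ 0} := by
      ext ω
      simp
    rw [hset, hcum 0 hk]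
    simp
    ring
  | succ k =>
    have hset : A ∩ κ ⁻¹' {k + 1} = (A ∩ {ω | κ ω ≤ k + 1}) \ (A ∩ {ω | κ ω ≤ k}) := by
      ext ω
      simp only [Set.mem_inter_iff, Set.mem_preimage, Set.mem_singleton_iff, Set.mem_sdiff,
        Set.mem_ofPred_eq]
      constructor
      · rintro ⟨h1, h2⟩
        exact ⟨⟨h1, h2.le⟩, fun h3 => by have := h3.2; omega⟩
      · rintro ⟨⟨h1, h2⟩, h3⟩
        refine ⟨h1, ?_⟩
        by_contra hne
        exact h3 ⟨h1, by omega⟩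
    have hsub : A ∩ {ω | κ ω ≤ k} ⊆ A ∩ {ω | κ ω ≤ k + 1} :=
      fun ω hω => ⟨hω.1, Nat.le_succ_of_le hω.2⟩
    rw [hset, measureReal_sdiff hsub (hA.inter (measurableSet_le hκ measurable_const)),
      hcum (k + 1) hk, hcum k (by omega)]
    push_cast
    ring

/-- Dilatation monotonicity up to a small constant. -/
lemma IsLawInvariantUtility.le_average_add {V : (Ω → ℝ) → ℝ} (hV : IsLawInvariantUtility μ V)
    (h : AtomlessMeasure μ) {f : Ω → ℝ} (hf : Measurable f) {M : ℝ} (hM : ∀ ω, |f ω| ≤ M)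
    {A : Set Ω} (hA : MeasurableSet A) (hA0 : 0 < μ.real A) {m : ℝ}
    (hm : ∫ ω in A, f ω ∂μ ≤ m * μ.real A) {N : ℕ} (hN : 0 < N) :
    V f ≤ V (A.indicator (fun _ => m + 2 * M / N) + Aᶜ.indicator f) := by
  have hN' : (0 : ℝ) < N := by exact_mod_cast hN
  have : NeZero N := ⟨hN.ne'⟩
  have hfb : f ∈ boundedMeasurable Ω := ⟨hf, M, hM⟩
  obtain ⟨κ, hκ, hκN, hord, hcell⟩ := h.exists_ordered_equipartition hf hM hA hN
  let u : ℕ → ℝ := fun k => sSup (f '' (A ∩ {ω | κ ω ≤ k}))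
  have hbdd : ∀ k, BddAbove (f '' (A ∩ {ω | κ ω ≤ k})) := by
    refine fun k => ⟨M, ?_⟩
    rintro _ ⟨ω, -, rfl⟩
    exact (abs_le.1 (hM ω)).2
  have hne : ∀ k < N, (A ∩ κ ⁻¹' {k}).Nonempty := by
    intro k hk
    refine Set.nonempty_iff_ne_empty.2 fun he => ?_
    have := hcell k hk
    rw [he, measureReal_empty] at this
    have : 0 < μ.real A / N := by positivity
    linarith
  have hne' : ∀ k < N, (f '' (A ∩ {ω | κ ω ≤ k})).Nonempty := fun k hk => by
    obtain ⟨ω, hω, hωk⟩ := hne k hk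
    exact ⟨f ω, ω, ⟨hω, le_of_eq hωk⟩, rfl⟩
  have huM : ∀ k < N, u k ≤ M := by
    refine fun k hk => csSup_le (hne' k hk) ?_
    rintro _ ⟨ω, -, rfl⟩
    exact (abs_le.1 (hM ω)).2
  have hfu : ∀ ω ∈ A, f ω ≤ u (κ ω) := fun ω hω =>
    le_csSup (hbdd _) ⟨ω, ⟨hω, show κ ω ≤ κ ω from le_rfl⟩, rfl⟩
  let l : ℕ → ℝ := fun k => Nat.casesOn k (-M) u
  have hlf : ∀ ω ∈ A, l (κ ω) ≤ f ω := by
    intro ω hω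
    rcases hk : κ ω with _ | k
    · exact (abs_le.1 (hM ω)).1
    · have hkN := hκN ω
      refine csSup_le (hne' k (by omega)) ?_
      rintro _ ⟨ω', ⟨hω', hωk'⟩, rfl⟩
      have hωk : κ ω' ≤ k := hωk'
      exact hord ω' hω' ω hω (by omega)
  have hmean : (∑ k ∈ Finset.range N, u k) / N ≤ m + 2 * M / N := by
    have h1 : ∫ ω in A, l (κ ω) ∂μ ≤ ∫ ω in A, f ω ∂μ :=
      setIntegral_mono_on
        (integrable_of_mem_boundedMeasurable
          (comp_nat_mem_boundedMeasurable hκ (fun ω => (hκN ω).le) l)).integrableOn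
        (integrable_of_mem_boundedMeasurable hfb).integrableOn hA hlf
    rw [setIntegral_comp_nat hκ hκN A, Finset.sum_congr rfl
      (fun k hk => by rw [hcell k (Finset.mem_range.1 hk)]), ← Finset.sum_mul] at h1
    obtain ⟨n, rfl⟩ : ∃ n, N = n + 1 := ⟨N - 1, by omega⟩
    have hl : ∑ k ∈ Finset.range (n + 1), l k = ∑ k ∈ Finset.range n, u k - M := by
      rw [Finset.sum_range_succ']
      rfl
    have hu : ∑ k ∈ Finset.range (n + 1), u k = ∑ k ∈ Finset.range n, u k + u n :=
      Finset.sum_range_succ _ _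
    have hun := huM n (by omega)
    have h2 := h1.trans hm
    rw [hl, mul_div_assoc', div_le_iff₀ hN'] at h2
    have h3 : (∑ k ∈ Finset.range n, u k - M) ≤ m * (n + 1 : ℕ) := by
      refine le_of_mul_le_mul_right ?_ hA0
      linarith
    rw [hu, div_le_iff₀ hN', add_mul, div_mul_cancel₀ _ hN'.ne']
    linarith
  let κ' : Ω → Fin N := fun ω => Fin.ofNat N (κ ω)
  have hκ' : Measurable κ' := (measurable_from_nat (f := Fin.ofNat N)).comp hκ
  have hval : ∀ ω, (κ' ω : ℕ) = κ ω := fun ω => by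
    simp [κ', Nat.mod_eq_of_lt (hκN ω)]
  have hrot := hV.le_rotation_average hA hκ' (c := ENNReal.ofReal (μ.real A / N)) (by
    intro k
    have hset : κ' ⁻¹' {k} ∩ A = A ∩ κ ⁻¹' {(k : ℕ)} := by
      ext ω
      simp only [Set.mem_inter_iff, Set.mem_preimage, Set.mem_singleton_iff, Fin.ext_iff, hval]
      exact and_comm
    rw [hset, ← hcell k k.2]
    simp [Measure.real]) (fun k => u k) hfb
  have hub : ((fun k : Fin N => u k) ∘ κ') ∈ boundedMeasurable Ω := by
    have : ((fun k : Fin N => u k) ∘ κ') = u ∘ κ := by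
      ext ω
      simp [hval]
    rw [this]
    exact comp_nat_mem_boundedMeasurable hκ (fun ω => (hκN ω).le) u
  have hmem : ∀ g ∈ boundedMeasurable Ω, A.indicator g + Aᶜ.indicator f ∈ boundedMeasurable Ω :=
    fun g hg => indicator_add_indicator_compl_mem_boundedMeasurable hA hg hfb
  calc V f ≤ V (A.indicator ((fun k : Fin N => u k) ∘ κ') + Aᶜ.indicator f) := by
        refine hV.mono _ hfb _ (hmem _ hub) (Eventually.of_forall fun ω => ?_)
        by_cases hω : ω ∈ A
        · simpa [hω, hval] using hfu ω hω
        · simp [hω]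
    _ ≤ _ := hrot
    _ ≤ _ := by
        refine hV.mono _ (hmem _ (const_mem_boundedMeasurable _)) _
          (hmem _ (const_mem_boundedMeasurable _)) (Eventually.of_forall fun ω => ?_)
        by_cases hω : ω ∈ A
        · simpa [hω, Fin.sum_univ_eq_sum_range] using hmean
        · simp [hω]

/-- Dilatation monotonicity: replacing `f` by its mean over `A` increases the utility. -/
lemma IsLawInvariantUtility.le_average {V : (Ω → ℝ) → ℝ} (hV : IsLawInvariantUtility μ V)
    (h : AtomlessMeasure μ) {f : Ω → ℝ} (hf : f ∈ boundedMeasurable Ω)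
    {A : Set Ω} (hA : MeasurableSet A) (hA0 : 0 < μ.real A) {m : ℝ}
    (hm : ∫ ω in A, f ω ∂μ ≤ m * μ.real A) :
    V f ≤ V (A.indicator (fun _ => m) + Aᶜ.indicator f) := by
  have hmem : ∀ c, A.indicator (fun _ => c) + Aᶜ.indicator f ∈ boundedMeasurable Ω := fun c =>
    indicator_add_indicator_compl_mem_boundedMeasurable hA (const_mem_boundedMeasurable c) hf
  refine le_of_forall_pos_le_add fun ε hε => ?_
  obtain ⟨δ, hδ, hVδ⟩ := hV.usc _ (hmem m) ε hε
  obtain ⟨hfm, M, hM⟩ := hf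
  obtain ⟨N, hN⟩ := exists_nat_gt (max (2 * M / δ) 0)
  have hN' : (0 : ℝ) < N := (le_max_right _ _).trans_lt hN
  have hMN : 2 * M / N ≤ δ := by
    have := (le_max_left _ _).trans_lt hN
    rw [div_lt_iff₀ hδ] at this
    rw [div_le_iff₀ hN']
    linarith
  refine (hV.le_average_add h hfm hM hA hA0 hm (Nat.cast_pos.1 hN')).trans (le_trans ?_ hVδ)
  obtain ⟨hgm, C, hC⟩ := hmem m
  refine hV.mono _ (hmem _) _ ⟨hgm.add_const δ, C + |δ|, fun ω => (abs_add_le _ _).trans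
    (add_le_add_left (hC ω) _)⟩ (Eventually.of_forall fun ω => ?_)
  by_cases hω : ω ∈ A
  · simpa [hω] using hMN
  · simpa [hω] using hδ.le

/-- A mean-preserving transfer from a lower coordinate to a higher one decreases a concave function
that increases under averaging. -/
lemma le_of_transfer {F : (ℕ → ℝ) → ℝ} (hconc : ConcaveOn ℝ Set.univ F) {p : ℕ → ℝ} {i j : ℕ}
    (hij : i ≠ j) (hi : 0 < p i) (hj : 0 < p j)
    (havg : ∀ (y : ℕ → ℝ) (m : ℝ), p i * y i + p j * y j = m * (p i + p j) →
      F y ≤ F (Function.update (Function.update y i m) j m))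
    {y y' : ℕ → ℝ} {δ : ℝ} (hδ : 0 ≤ δ) (hy : y i < y j) (hy'i : y' i = y i - δ / p i)
    (hy'j : y' j = y j + δ / p j) (hy' : ∀ k, k ≠ i → k ≠ j → y' k = y k) : F y' ≤ F y := by
  set m := (p i * y i + p j * y j) / (p i + p j) with hm
  have hpp : 0 < p i + p j := by linarith
  have hsum : p i * y i + p j * y j = m * (p i + p j) := by
    rw [hm, div_mul_cancel₀ _ hpp.ne']
  have hmi : 0 < m - y i := by
    have : (m - y i) * (p i + p j) = p j * (y j - y i) := by linarith
    exact pos_of_mul_pos_left (this ▸ mul_pos hj (sub_pos.2 hy)) hpp.le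
  have hδi : 0 ≤ δ / p i := by positivity
  set c := δ / p i / (m - y i + δ / p i) with hc
  have hden : 0 < m - y i + δ / p i := by linarith
  have hc0 : 0 ≤ c := by positivity
  have hc1 : c ≤ 1 := by
    rw [hc, div_le_one hden]
    linarith
  have hcm : c * (m - y i + δ / p i) = δ / p i := by
    rw [hc, div_mul_cancel₀ _ hden.ne']
  set y'' := Function.update (Function.update y' i m) j m
  have hle : F y' ≤ F y'' := by
    refine havg y' m ?_
    rw [hy'i, hy'j, mul_sub, mul_add, mul_div_cancel₀ _ hi.ne', mul_div_cancel₀ _ hj.ne']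
    linarith
  have hyc : (1 - c) • y' + c • y'' = y := by
    ext k
    simp only [Pi.add_apply, Pi.smul_apply, smul_eq_mul]
    by_cases hki : k = i
    · subst hki
      simp only [y'', Function.update_of_ne hij, Function.update_self, hy'i]
      linarith
    · by_cases hkj : k = j
      · subst hkj
        simp only [y'', Function.update_self, hy'j]
        have h1 : δ = p i * (c * (m - y i + δ / p i)) := by
          rw [hcm, mul_div_cancel₀ _ hi.ne']
        have h2 : p i * (m - y i) = p k * (y k - m) := by linarith
        have h3 : p i * (m - y i + δ / p i) = p k * (y k - m) + δ := by
          rw [mul_add, mul_div_cancel₀ _ hi.ne', h2]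
        have h4 : δ = c * (p k * (y k - m) + δ) := by
          rw [← h3]
          linarith
        have h5 : p k * (δ / p k) = δ := mul_div_cancel₀ _ hj.ne'
        refine mul_left_cancel₀ hj.ne' ?_
        linear_combination (1 - c) * h5 + h4
      · simp only [y'', Function.update_of_ne hkj, Function.update_of_ne hki, hy' k hki hkj]
        ring
  have := hconc.2 (Set.mem_univ y') (Set.mem_univ y'') (sub_nonneg.2 hc1) hc0 (by ring)
  rw [hyc, smul_eq_mul, smul_eq_mul] at this
  nlinarith

lemma eventually_le_of_dominated {F : (ℕ → ℝ) → ℝ} (hconc : ConcaveOn ℝ Set.univ F) {p : ℕ → ℝ}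
    {S : Finset ℕ} (hp : ∀ k ∈ S, 0 < p k)
    (hmono : ∀ y y' : ℕ → ℝ, (∀ k ∈ S, y k ≤ y' k) → F y ≤ F y')
    (havg : ∀ i ∈ S, ∀ j ∈ S, i < j → ∀ (y : ℕ → ℝ) (m : ℝ),
      p i * y i + p j * y j = m * (p i + p j) →
      F y ≤ F (Function.update (Function.update y i m) j m))
    {β : ℕ → ℝ} (hβ : StrictMono β) (T : Finset ℕ) (hTS : T ⊆ S) (v : ℕ → ℝ)
    (hv : ∀ k ∉ T, v k = 0) (hdom : ∀ r ∈ T, ∑ k ∈ T with k ≤ r, p k * v k ≤ 0) :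
    ∀ᶠ t : ℝ in nhdsWithin 0 (Set.Ioi 0), F (β + t • v) ≤ F β := by
  induction T using Finset.induction_on_max generalizing v with
  | empty =>
    have : v = 0 := by
      ext k
      exact hv k (by simp)
    simp [this]
  | insert a T haT ih =>
    have haT' : a ∉ T := fun h => lt_irrefl a (haT a h)
    have haS : a ∈ S := hTS (Finset.mem_insert_self a T)
    have hTS' : T ⊆ S := (Finset.subset_insert a T).trans hTS
    have hfil : ∀ r ∈ T, {k ∈ insert a T | k ≤ r} = {k ∈ T | k ≤ r} := fun r hr => by
      rw [Finset.filter_insert, if_neg (not_le.2 (haT r hr))]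
    by_cases hva : v a ≤ 0
    · have hIH := ih hTS' (Function.update v a 0) (fun k hk => by
        by_cases hka : k = a
        · simp [hka]
        · rw [Function.update_of_ne hka]
          exact hv k (by simp [hka, hk])) (fun r hr => by
        have := hdom r (Finset.mem_insert_of_mem hr)
        rw [hfil r hr] at this
        refine le_of_eq_of_le (Finset.sum_congr rfl fun k hk => ?_) this
        have hka : k ≠ a := fun h => haT' (h ▸ (Finset.mem_filter.1 hk).1)
        rw [Function.update_of_ne hka])
      filter_upwards [hIH, self_mem_nhdsWithin] with t ht ht0
      refine (hmono _ _ fun k _ => ?_).trans ht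
      have ht0' : (0 : ℝ) < t := ht0
      by_cases hka : k = a
      · subst hka
        simpa using mul_nonpos_of_nonneg_of_nonpos ht0'.le hva
      · simp [Function.update_of_ne hka]
    · push Not at hva
      have htot := hdom a (Finset.mem_insert_self a T)
      have hfa : {k ∈ insert a T | k ≤ a} = insert a T :=
        Finset.filter_true_of_mem fun k hk => by
          rcases Finset.mem_insert.1 hk with h | h
          · exact h.le
          · exact (haT k h).le
      rw [hfa, Finset.sum_insert haT'] at htot
      have hpa := hp a haS
      have hpv : 0 < p a * v a := mul_pos hpa hva
      have hTne : T.Nonempty := by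
        rw [Finset.nonempty_iff_ne_empty]
        rintro rfl
        rw [Finset.sum_empty] at htot
        linarith
      set r := T.max' hTne
      have hrT : r ∈ T := T.max'_mem hTne
      have hra : r < a := haT r hrT
      have hpr := hp r (hTS' hrT)
      set v' := Function.update (Function.update v a 0) r (v r + p a * v a / p r) with hv'
      have hv'T : ∀ k ∈ T, p k * v' k = p k * v k + if k = r then p a * v a else 0 := by
        intro k hk
        have hka : k ≠ a := fun h => haT' (h ▸ hk)
        by_cases hkr : k = r
        · rw [hkr, if_pos rfl, hv', Function.update_self, mul_add, mul_div_cancel₀ _ hpr.ne']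
        · rw [if_neg hkr, hv', Function.update_of_ne hkr, Function.update_of_ne hka, add_zero]
      have hIH := ih hTS' v' (fun k hk => by
        have hkr : k ≠ r := fun h => hk (h ▸ hrT)
        rw [hv', Function.update_of_ne hkr]
        by_cases hka : k = a
        · simp [hka]
        · rw [Function.update_of_ne hka]
          exact hv k (by simp [hka, hk])) (fun s hs => by
        rw [Finset.sum_congr rfl fun k hk => hv'T k (Finset.mem_filter.1 hk).1,
          Finset.sum_add_distrib, Finset.sum_ite_eq']
        have hs' := hdom s (Finset.mem_insert_of_mem hs)
        rw [hfil s hs] at hs'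
        by_cases hrs : r ≤ s
        · have hfs : {k ∈ T | k ≤ s} = T :=
            Finset.filter_true_of_mem fun k hk => (T.le_max' k hk).trans hrs
          rw [hfs, if_pos hrT]
          linarith
        · rw [if_neg (by simp [hrs])]
          linarith)
      have hcont : ∀ᶠ t : ℝ in nhdsWithin 0 (Set.Ioi 0), β r + t * v' r < β a + t * v' a := by
        refine nhdsWithin_le_nhds ?_
        have h1 : Continuous fun t : ℝ => β r + t * v' r := by fun_prop
        have h2 : Continuous fun t : ℝ => β a + t * v' a := by fun_prop
        exact (isOpen_lt h1 h2).mem_nhds (by simpa using hβ hra)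
      filter_upwards [hIH, hcont, self_mem_nhdsWithin] with t ht htc ht0
      have ht0' : (0 : ℝ) < t := ht0
      refine (le_of_transfer hconc hra.ne hpr hpa (havg r (hTS' hrT) a haS hra)
        (y := β + t • v') (δ := t * (p a * v a)) (by positivity) (by simpa using htc)
        ?_ ?_ ?_).trans ht
      · simp only [Pi.add_apply, Pi.smul_apply, smul_eq_mul, hv', Function.update_self]
        ring
      · simp only [Pi.add_apply, Pi.smul_apply, smul_eq_mul, hv', Function.update_self,
          Function.update_of_ne hra.ne']
        field_simp
        ring
      · intro k hkr hka
        simp [hv', Function.update_of_ne hkr, Function.update_of_ne hka]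

/-- Weighted weak majorization inequality for concave functions that increase under averaging. -/
lemma le_of_dominated {F : (ℕ → ℝ) → ℝ} (hconc : ConcaveOn ℝ Set.univ F) {p : ℕ → ℝ}
    {S : Finset ℕ} (hp : ∀ k ∈ S, 0 < p k)
    (hmono : ∀ y y' : ℕ → ℝ, (∀ k ∈ S, y k ≤ y' k) → F y ≤ F y')
    (havg : ∀ i ∈ S, ∀ j ∈ S, i < j → ∀ (y : ℕ → ℝ) (m : ℝ),
      p i * y i + p j * y j = m * (p i + p j) →
      F y ≤ F (Function.update (Function.update y i m) j m))
    {β : ℕ → ℝ} (hβ : StrictMono β) (a : ℕ → ℝ)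
    (hdom : ∀ r ∈ S, ∑ k ∈ S with k ≤ r, p k * (a k - β k) ≤ 0) : F a ≤ F β := by
  let v : ℕ → ℝ := (S : Set ℕ).indicator (a - β)
  have hvS : ∀ k ∈ S, v k = a k - β k := fun k hk => by simp [v, hk]
  have hev := eventually_le_of_dominated hconc hp hmono havg hβ S subset_rfl v
    (fun k hk => by simp [v, hk]) (fun r hr => le_of_eq_of_le
      (Finset.sum_congr rfl fun k hk => by rw [hvS k (Finset.mem_filter.1 hk).1]) (hdom r hr))
  obtain ⟨t, ht, ht0, ht1⟩ := (hev.and (Ioo_mem_nhdsGT (zero_lt_one' ℝ))).exists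
  have hle : F a ≤ F (β + v) := hmono _ _ fun k hk => by simp [hvS k hk]
  have := hconc.2 (Set.mem_univ β) (Set.mem_univ (β + v)) (sub_nonneg.2 ht1.le) ht0.le (by ring)
  have hcomb : (1 - t) • β + t • (β + v) = β + t • v := by
    ext k
    simp
    ring
  rw [hcomb, smul_eq_mul, smul_eq_mul] at this
  have h2 : t * F (β + v) ≤ t * F β := by linarith
  exact hle.trans (le_of_mul_le_mul_left h2 ht0)

/-- Averaging a function over finitely many cells increases the utility. -/
lemma IsLawInvariantUtility.le_average_cells {V : (Ω → ℝ) → ℝ} (hV : IsLawInvariantUtility μ V)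
    (h : AtomlessMeasure μ) {f : Ω → ℝ} (hf : f ∈ boundedMeasurable Ω) {κ : Ω → ℕ}
    (hκ : Measurable κ) {S : Finset ℕ} (hS : ∀ k ∈ S, 0 < μ.real (κ ⁻¹' {k})) {a : ℕ → ℝ}
    (ha : ∀ k ∈ S, ∫ ω in κ ⁻¹' {k}, f ω ∂μ = a k * μ.real (κ ⁻¹' {k}))
    (hae : ∀ᵐ ω ∂μ, κ ω ∈ S) (hab : a ∘ κ ∈ boundedMeasurable Ω) : V f ≤ V (a ∘ κ) := by
  have hcells : ∀ T ⊆ S, ∃ g ∈ boundedMeasurable Ω, V f ≤ V g ∧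
      ∀ ω, (κ ω ∈ T → g ω = a (κ ω)) ∧ (κ ω ∉ T → g ω = f ω) := by
    intro T
    induction T using Finset.induction_on with
    | empty => exact fun _ => ⟨f, hf, le_rfl, fun ω => by simp⟩
    | insert k T hkT ih =>
      intro hT
      have hkS : k ∈ S := hT (Finset.mem_insert_self k T)
      obtain ⟨g, hg, hfg, hgω⟩ := ih ((Finset.subset_insert k T).trans hT)
      have hm : MeasurableSet (κ ⁻¹' {k}) := hκ (measurableSet_singleton k)
      refine ⟨(κ ⁻¹' {k}).indicator (fun _ => a k) + (κ ⁻¹' {k})ᶜ.indicator g,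
        indicator_add_indicator_compl_mem_boundedMeasurable hm (const_mem_boundedMeasurable _) hg,
        hfg.trans (hV.le_average h hg hm (hS k hkS) ?_), fun ω => ?_⟩
      · rw [← ha k hkS]
        refine (setIntegral_congr_fun hm fun ω hω => ?_).le
        have hωk : κ ω = k := hω
        exact (hgω ω).2 (hωk ▸ hkT)
      · by_cases hωk : κ ω = k
        · simp [hωk]
        · simpa [hωk] using hgω ω
  obtain ⟨g, hg, hfg, hgω⟩ := hcells S subset_rfl
  refine hfg.trans (hV.mono _ hg _ hab ?_)
  filter_upwards [hae] with ω hω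
  exact ((hgω ω).1 hω).le

/-- The integrated quantile inequality for comonotone functions ordered by second-order stochastic
dominance. -/
lemma setIntegral_le_of_integral_min_le {f g : Ω → ℝ} (hf : Integrable f μ) (hg : Integrable g μ)
    {D : Set Ω} (hD : MeasurableSet D) {z : ℝ} (hle : ∀ ω ∈ D, f ω ≤ z)
    (hge : ∀ᵐ ω ∂μ, ω ∉ D → z ≤ f ω)
    (hmin : ∫ ω, min (f ω) z ∂μ ≤ ∫ ω, min (g ω) z ∂μ) :
    ∫ ω in D, f ω ∂μ ≤ ∫ ω in D, g ω ∂μ := by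
  have hfz : ∫ ω, (min (f ω) z - z) ∂μ = ∫ ω in D, (f ω - z) ∂μ := by
    rw [← integral_indicator hD]
    refine integral_congr_ae ?_
    filter_upwards [hge] with ω hω
    by_cases hωD : ω ∈ D
    · simp [hωD, hle ω hωD]
    · simp [hωD, hω hωD]
  have hgz : ∫ ω, (min (g ω) z - z) ∂μ ≤ ∫ ω in D, (g ω - z) ∂μ := by
    rw [← integral_indicator hD]
    refine integral_mono ((hg.inf (integrable_const z)).sub (integrable_const z))
      ((hg.sub (integrable_const z)).indicator hD) fun ω => ?_
    by_cases hωD : ω ∈ D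
    · simp [hωD]
    · simp [hωD]
  have hi : ∀ u : Ω → ℝ, Integrable u μ → Integrable (fun ω => min (u ω) z) μ :=
    fun u hu => hu.inf (integrable_const z)
  rw [integral_sub hf.integrableOn (integrable_const z).integrableOn,
    integral_sub (hi f hf) (integrable_const z)] at hfz
  rw [integral_sub hg.integrableOn (integrable_const z).integrableOn,
    integral_sub (hi g hg) (integrable_const z)] at hgz
  linarith

/-- Second-order dominance is preserved when the dominating variable is simple and comonotone with
the dominated one. -/
lemma IsLawInvariantUtility.le_of_comonotone_simple {V : (Ω → ℝ) → ℝ}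
    (hV : IsLawInvariantUtility μ V) (h : AtomlessMeasure μ) {f : Ω → ℝ}
    (hf : f ∈ boundedMeasurable Ω) {κ : Ω → ℕ} (hκ : Measurable κ) {K : ℕ} (hK : ∀ ω, κ ω ≤ K)
    (hord : ∀ ω ω', κ ω < κ ω' → f ω ≤ f ω') {β : ℕ → ℝ} (hβ : StrictMono β)
    (hmin : ∀ z, ∫ ω, min (f ω) z ∂μ ≤ ∫ ω, min (β (κ ω)) z ∂μ) : V f ≤ V (β ∘ κ) := by
  let p : ℕ → ℝ := fun k => μ.real (κ ⁻¹' {k})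
  let S : Finset ℕ := {k ∈ Finset.range (K + 1) | 0 < p k}
  have hS : ∀ k ∈ S, 0 < p k := fun k hk => (Finset.mem_filter.1 hk).2
  have hm : ∀ T : Set ℕ, MeasurableSet (κ ⁻¹' T) := fun T => hκ T.to_countable.measurableSet
  have hb : ∀ y : ℕ → ℝ, y ∘ κ ∈ boundedMeasurable Ω := comp_nat_mem_boundedMeasurable hκ hK
  have hae : ∀ᵐ ω ∂μ, κ ω ∈ S := by
    have h0 : ∀ᵐ ω ∂μ, ∀ k, p k = 0 → κ ω ≠ k := by
      rw [ae_all_iff]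
      intro k
      by_cases hk : p k = 0
      · have : μ (κ ⁻¹' {k}) = 0 := (measureReal_eq_zero_iff).1 hk
        filter_upwards [measure_eq_zero_iff_ae_notMem.1 this] with ω hω _
        exact hω
      · exact Eventually.of_forall fun ω hk' => absurd hk' hk
    filter_upwards [h0] with ω hω
    refine Finset.mem_filter.2 ⟨Finset.mem_range.2 (Nat.lt_succ_of_le (hK ω)), ?_⟩
    exact measureReal_nonneg.lt_of_ne fun he => hω _ he.symm rfl
  let a : ℕ → ℝ := fun k => (∫ ω in κ ⁻¹' {k}, f ω ∂μ) / p k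
  have ha : ∀ k ∈ S, ∫ ω in κ ⁻¹' {k}, f ω ∂μ = a k * p k := fun k hk =>
    (div_mul_cancel₀ _ (hS k hk).ne').symm
  refine (hV.le_average_cells h hf hκ hS ha hae (hb a)).trans ?_
  refine le_of_dominated (F := fun y => V (y ∘ κ)) (p := p) (S := S) ?_ hS ?_ ?_ hβ a ?_
  · exact ⟨convex_univ, fun y _ y' _ s t hs ht hst => hV.conc.2 (hb y) (hb y') hs ht hst⟩
  · intro y y' hy
    refine hV.mono _ (hb y) _ (hb y') ?_
    filter_upwards [hae] with ω hω
    exact hy _ hω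
  · intro i hi j hj hij y m hym
    have hset : κ ⁻¹' {i, j} = κ ⁻¹' {i} ∪ κ ⁻¹' {j} := by
      ext ω
      simp
    have hdisj : Disjoint (κ ⁻¹' {i}) (κ ⁻¹' {j}) :=
      Disjoint.preimage _ (Set.disjoint_singleton.2 hij.ne)
    have hpij : μ.real (κ ⁻¹' {i, j}) = p i + p j := by
      rw [hset, measureReal_union hdisj (hm _)]
    have hconst : ∀ k, ∫ ω in κ ⁻¹' {k}, (y ∘ κ) ω ∂μ = p k * y k := by
      intro k
      rw [setIntegral_congr_fun (g := fun _ => y k) (hm _) fun ω hω => by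
        have hωk : κ ω = k := hω
        simp [hωk], setIntegral_const, smul_eq_mul]
    have hle := hV.le_average h (hb y) (hm {i, j}) (m := m)
      (by rw [hpij]; exact add_pos (hS i hi) (hS j hj)) (by
        rw [hpij, ← hym, hset, setIntegral_union hdisj (hm _)
          (integrable_of_mem_boundedMeasurable (hb y)).integrableOn
          (integrable_of_mem_boundedMeasurable (hb y)).integrableOn, hconst, hconst])
    refine hle.trans (le_of_eq (congrArg V ?_))
    ext ω
    by_cases hωj : κ ω = j
    · simp [hωj]
    · by_cases hωi : κ ω = i
      · simp [hωi, Function.update_of_ne hij.ne]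
      · simp [hωi, hωj]
  · intro r hr
    set T : Finset ℕ := {k ∈ S | k ≤ r} with hT
    have hrT : r ∈ T := Finset.mem_filter.2 ⟨hr, le_rfl⟩
    have hne : (κ ⁻¹' (T : Set ℕ)).Nonempty := by
      refine Set.nonempty_iff_ne_empty.2 fun he => ?_
      have hsub : κ ⁻¹' {r} ⊆ κ ⁻¹' (T : Set ℕ) :=
        Set.preimage_mono (Set.singleton_subset_iff.2 hrT)
      have h0 : p r ≤ μ.real (κ ⁻¹' (T : Set ℕ)) := measureReal_mono hsub
      rw [he, measureReal_empty] at h0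
      exact absurd (hS r hr) (not_lt.2 h0)
    have hUnion : κ ⁻¹' (T : Set ℕ) = ⋃ k ∈ T, κ ⁻¹' {k} := by
      ext ω
      simp
    have hfi : Integrable f μ := integrable_of_mem_boundedMeasurable hf
    have hβi : Integrable (β ∘ κ) μ := integrable_of_mem_boundedMeasurable (hb β)
    have hsum : ∀ g : Ω → ℝ, Integrable g μ →
        ∫ ω in κ ⁻¹' (T : Set ℕ), g ω ∂μ = ∑ k ∈ T, ∫ ω in κ ⁻¹' {k}, g ω ∂μ := by
      intro g hg
      rw [hUnion, integral_biUnion_finset T (fun k _ => hm _)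
        (fun i _ j _ hij => Disjoint.preimage _ (Set.disjoint_singleton.2 hij))
        fun k _ => hg.integrableOn]
    have hcell : ∀ k ∈ T, p k * (a k - β k) =
        ∫ ω in κ ⁻¹' {k}, f ω ∂μ - ∫ ω in κ ⁻¹' {k}, (β ∘ κ) ω ∂μ := by
      intro k hk
      rw [ha k (Finset.mem_filter.1 hk).1, setIntegral_congr_fun (g := fun _ => β k) (hm _)
        fun ω hω => by
          have hωk : κ ω = k := hω
          simp [hωk], setIntegral_const, smul_eq_mul]
      ring
    rw [Finset.sum_congr rfl hcell, Finset.sum_sub_distrib, ← hsum f hfi, ← hsum _ hβi,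
      sub_nonpos]
    obtain ⟨M, hM⟩ := hf.2
    refine setIntegral_le_of_integral_min_le hfi hβi (hm _)
      (z := sSup (f '' (κ ⁻¹' (T : Set ℕ)))) (fun ω hω => le_csSup ⟨M, ?_⟩ ⟨ω, hω, rfl⟩) ?_ (hmin _)
    · rintro _ ⟨ω', -, rfl⟩
      exact (abs_le.1 (hM ω')).2
    · filter_upwards [hae] with ω hωS hω
      refine csSup_le (hne.image f) ?_
      rintro _ ⟨ω', hω', rfl⟩
      have hωT : κ ω' ∈ T := hω'
      refine hord ω' ω (lt_of_le_of_lt (Finset.mem_filter.1 hωT).2 (not_le.1 fun hle => hω ?_))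
      exact Finset.mem_filter.2 ⟨hωS, hle⟩

/-- Law-invariant utilities preserve second-order stochastic dominance, expressed through the
functions `min · z`. -/
lemma IsLawInvariantUtility.le_of_integral_min_le {V : (Ω → ℝ) → ℝ}
    (hV : IsLawInvariantUtility μ V) (h : AtomlessMeasure μ) {f g : Ω → ℝ}
    (hf : f ∈ boundedMeasurable Ω) (hg : g ∈ boundedMeasurable Ω)
    (hmin : ∀ z, ∫ ω, min (f ω) z ∂μ ≤ ∫ ω, min (g ω) z ∂μ) : V f ≤ V g := by
  refine le_of_forall_pos_le_add fun ε hε => ?_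
  obtain ⟨δ, hδ, hVδ⟩ := hV.usc g hg ε hε
  obtain ⟨hgm, M, hM⟩ := id hg
  obtain ⟨hfm, C, hC⟩ := id hf
  let κ₀ : Ω → ℕ := fun ω => ⌈(g ω + M) / δ⌉₊
  have hκ₀ : Measurable κ₀ := Nat.measurable_ceil.comp ((hgm.add_const M).div_const δ)
  have hκ₀K : ∀ ω, κ₀ ω ≤ ⌈2 * M / δ⌉₊ := by
    intro ω
    have := (abs_le.1 (hM ω)).2
    refine Nat.ceil_mono ?_
    gcongr
    linarith
  let β : ℕ → ℝ := fun k => δ * k - M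
  have hβ : StrictMono β := fun i j hij => by
    have : (i : ℝ) < j := by exact_mod_cast hij
    simp only [β]
    gcongr
  have hle : ∀ ω, g ω ≤ β (κ₀ ω) := by
    intro ω
    have := Nat.le_ceil ((g ω + M) / δ)
    rw [div_le_iff₀ hδ] at this
    simp only [β, κ₀]
    linarith
  have hge : ∀ ω, β (κ₀ ω) ≤ g ω + δ := by
    intro ω
    have h0 : 0 ≤ (g ω + M) / δ := by
      have := (abs_le.1 (hM ω)).1
      refine div_nonneg ?_ hδ.le
      linarith
    have := (Nat.ceil_lt_add_one h0).le
    have h2 : δ * ((⌈(g ω + M) / δ⌉₊ : ℕ) : ℝ) ≤ δ * ((g ω + M) / δ + 1) := by gcongr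
    rw [mul_add, mul_div_cancel₀ _ hδ.ne'] at h2
    simp only [β, κ₀]
    linarith
  obtain ⟨κ, hκ, hκK, hord, hp⟩ := h.exists_ordered_index hfm hC MeasurableSet.univ ⌈2 * M / δ⌉₊
    (p := fun k => μ {ω | κ₀ ω ≤ k})
    (fun i j hij => measure_mono fun ω hω => le_trans (show κ₀ ω ≤ i from hω) hij)
    (fun k => measure_mono (Set.subset_univ _))
  have hlaw : μ.map κ = μ.map κ₀ := by
    have : IsProbabilityMeasure (μ.map κ) := Measure.isProbabilityMeasure_map hκ.aemeasurable
    refine Measure.ext_of_Iic _ _ fun k => ?_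
    rw [Measure.map_apply hκ measurableSet_Iic, Measure.map_apply hκ₀ measurableSet_Iic]
    rcases lt_or_ge k ⌈2 * M / δ⌉₊ with hk | hk
    · have hpk := hp k hk
      rw [Set.univ_inter] at hpk
      exact hpk
    · have h1 : κ ⁻¹' Set.Iic k = Set.univ := Set.eq_univ_of_forall fun ω => (hκK ω).trans hk
      have h2 : κ₀ ⁻¹' Set.Iic k = Set.univ := Set.eq_univ_of_forall fun ω => (hκ₀K ω).trans hk
      rw [h1, h2]
  have hb := comp_nat_mem_boundedMeasurable hκ hκK β
  have hb₀ := comp_nat_mem_boundedMeasurable hκ₀ hκ₀K β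
  have hβlaw : μ.map (β ∘ κ) = μ.map (β ∘ κ₀) := by
    rw [← Measure.map_map measurable_from_nat hκ, ← Measure.map_map measurable_from_nat hκ₀, hlaw]
  have hmin' : ∀ z, ∫ ω, min (f ω) z ∂μ ≤ ∫ ω, min (β (κ ω)) z ∂μ := by
    intro z
    have e : ∀ κ' : Ω → ℕ, Measurable κ' → ∫ ω, min (β (κ' ω)) z ∂μ =
        ∫ x, min x z ∂(μ.map (β ∘ κ')) := by
      intro κ' hκ'
      rw [integral_map ((measurable_from_nat (f := β)).comp hκ').aemeasurable]
      · rfl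
      · exact (continuous_id.min continuous_const).aestronglyMeasurable
    rw [e κ hκ, hβlaw, ← e κ₀ hκ₀]
    refine (hmin z).trans (integral_mono
      ((integrable_of_mem_boundedMeasurable hg).inf (integrable_const z))
      ((integrable_of_mem_boundedMeasurable hb₀).inf (integrable_const z))
      fun ω => min_le_min_right z (hle ω))
  refine (hV.le_of_comonotone_simple h hf hκ hκK (fun ω ω' => hord ω trivial ω' trivial) hβ
    hmin').trans ?_
  rw [hV.law _ hb _ hb₀ hβlaw]
  refine le_trans (hV.mono _ hb₀ _ ⟨hgm.add_const δ, M + |δ|, fun ω => (abs_add_le _ _).trans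
    (add_le_add_left (hM ω) _)⟩ (Eventually.of_forall hge)) hVδ

lemma memLp_top_of_mem_boundedMeasurable {f : Ω → ℝ} (hf : f ∈ boundedMeasurable Ω) :
    MemLp f ⊤ μ := by
  obtain ⟨hfm, M, hM⟩ := hf
  exact memLp_top_of_bound hfm.aestronglyMeasurable M (Eventually.of_forall hM)

lemma exists_boundedMeasurable_ae_eq (Z : Xinf μ) :
    ∃ f ∈ boundedMeasurable Ω, (Z : Ω → ℝ) =ᵐ[μ] f := by
  have hZ : Measurable (Z : Ω → ℝ) := (Lp.stronglyMeasurable Z).measurable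
  refine ⟨fun ω => max (-‖Z‖) (min (Z ω) ‖Z‖), ⟨measurable_const.max (hZ.min measurable_const),
    ‖Z‖, fun ω => ?_⟩, ?_⟩
  · have := norm_nonneg Z
    exact abs_le.2 ⟨le_max_left _ _, max_le (by linarith) (min_le_right _ _)⟩
  · filter_upwards [enorm_ae_le_eLpNormEssSup (Z : Ω → ℝ) μ] with ω hω
    have hωZ : |Z ω| ≤ ‖Z‖ := by
      rw [Lp.norm_def, eLpNorm_exponent_top, ← Real.norm_eq_abs, ← toReal_enorm]
      refine ENNReal.toReal_mono ?_ hω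
      simpa only [eLpNorm_exponent_top] using Lp.eLpNorm_ne_top Z
    obtain ⟨h1, h2⟩ := abs_le.1 hωZ
    rw [min_eq_left h2, max_eq_right h1]

open Classical in
/-- The functional on bounded measurable functions induced by a functional on `L^∞`. -/
def liftBounded (U : Xinf μ → ℝ) (f : Ω → ℝ) : ℝ :=
  if hf : f ∈ boundedMeasurable Ω then U ((memLp_top_of_mem_boundedMeasurable hf).toLp f) else 0

lemma liftBounded_of_ae_eq (U : Xinf μ → ℝ) {f : Ω → ℝ} (hf : f ∈ boundedMeasurable Ω)
    {Z : Xinf μ} (hZ : (Z : Ω → ℝ) =ᵐ[μ] f) : liftBounded U f = U Z := by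
  rw [liftBounded, dif_pos hf]
  exact congrArg U (Lp.ext ((MemLp.coeFn_toLp _).trans hZ.symm))

lemma convex_boundedMeasurable : Convex ℝ (boundedMeasurable Ω) := by
  rintro f ⟨hf, M, hM⟩ g ⟨hg, N, hN⟩ a b ha hb -
  refine ⟨(hf.const_smul a).add (hg.const_smul b), a * M + b * N, fun ω => ?_⟩
  simp only [Pi.add_apply, Pi.smul_apply, smul_eq_mul]
  refine (abs_add_le _ _).trans ?_
  rw [abs_mul, abs_mul, abs_of_nonneg ha, abs_of_nonneg hb]
  gcongr
  · exact hM ω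
  · exact hN ω

lemma isLawInvariantUtility_liftBounded {U : Xinf μ → ℝ} (hmono : UMonotone U)
    (hconc : ConcaveOn ℝ Set.univ U) (husc : UpperSemicontinuous U) (hlaw : LawInvariant U) :
    IsLawInvariantUtility μ (liftBounded U) := by
  have hlift : ∀ f ∈ boundedMeasurable Ω, ∃ Z : Xinf μ, (Z : Ω → ℝ) =ᵐ[μ] f := fun f hf =>
    ⟨(memLp_top_of_mem_boundedMeasurable hf).toLp f, MemLp.coeFn_toLp _⟩
  refine ⟨?_, ⟨convex_boundedMeasurable, ?_⟩, ?_, ?_⟩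
  · intro f hf g hg hfg
    obtain ⟨Y, hY⟩ := hlift f hf
    obtain ⟨Z, hZ⟩ := hlift g hg
    rw [liftBounded_of_ae_eq U hf hY, liftBounded_of_ae_eq U hg hZ]
    exact hmono _ _ ((Lp.coeFn_le _ _).1 (hY.le.trans (hfg.trans hZ.symm.le)))
  · intro f hf g hg a b ha hb hab
    obtain ⟨Y, hY⟩ := hlift f hf
    obtain ⟨Z, hZ⟩ := hlift g hg
    rw [liftBounded_of_ae_eq U hf hY, liftBounded_of_ae_eq U hg hZ,
      liftBounded_of_ae_eq (Z := a • Y + b • Z) U (convex_boundedMeasurable hf hg ha hb hab)]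
    · exact hconc.2 trivial trivial ha hb hab
    · filter_upwards [hY, hZ, Lp.coeFn_add (a • Y) (b • Z), Lp.coeFn_smul a Y,
        Lp.coeFn_smul b Z] with ω h1 h2 h3 h4 h5
      rw [h3, Pi.add_apply, h4, h5]
      simp [h1, h2]
  · intro f hf g hg hfg
    obtain ⟨Y, hY⟩ := hlift f hf
    obtain ⟨Z, hZ⟩ := hlift g hg
    rw [liftBounded_of_ae_eq U hf hY, liftBounded_of_ae_eq U hg hZ]
    refine hlaw _ _ ⟨(Lp.aestronglyMeasurable Y).aemeasurable,
      (Lp.aestronglyMeasurable Z).aemeasurable, ?_⟩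
    rw [Measure.map_congr hY, Measure.map_congr hZ, hfg]
  · intro f hf ε hε
    obtain ⟨Y, hY⟩ := hlift f hf
    rw [liftBounded_of_ae_eq U hf hY]
    have hev := husc Y (U Y + ε) (by linarith)
    have hcont : Continuous fun δ : ℝ => Y + Lp.constL ⊤ μ ℝ δ := by fun_prop
    have hev0 : ∀ᶠ δ : ℝ in nhdsWithin 0 (Set.Ioi 0), U (Y + Lp.constL ⊤ μ ℝ δ) < U Y + ε :=
      nhdsWithin_le_nhds (hcont.tendsto' 0 Y (by simp) |>.eventually hev)
    obtain ⟨δ, hδ, hδ0⟩ := (hev0.and self_mem_nhdsWithin).exists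
    refine ⟨δ, hδ0, ?_⟩
    obtain ⟨hfm, M, hM⟩ := hf
    rw [liftBounded_of_ae_eq (Z := Y + Lp.constL ⊤ μ ℝ δ) U ⟨hfm.add_const δ, M + |δ|,
      fun ω => (abs_add_le _ _).trans (add_le_add_left (hM ω) _)⟩]
    · exact hδ.le
    · filter_upwards [hY, Lp.coeFn_add Y (Lp.constL ⊤ μ ℝ δ),
        Lp.coeFn_const (p := ⊤) (μ := μ) δ] with ω h1 h2 h3
      rw [h2, Pi.add_apply, h1]
      exact congrArg (f ω + ·) h3

/-- For a monotone concave functional on `L^∞`, upper semicontinuous with respect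
to the norm topology, being S.S.D. preserving is equivalent to law invariance. -/
theorem ssdPreserving_iff_lawInvariant
    (hatomless : AtomlessMeasure μ) (U : Xinf μ → ℝ)
    (hmono : UMonotone U) (hconc : ConcaveOn ℝ Set.univ U)
    (husc : UpperSemicontinuous U) :
    SSDPreserving U ↔ LawInvariant U := by
  constructor
  · intro hssd Z₁ Z₂ hid
    have heq : ∀ φ : ℝ → ℝ, Monotone φ → ∫ ω, φ (Z₁ ω) ∂μ = ∫ ω, φ (Z₂ ω) ∂μ :=
      fun φ hφ => (hid.comp hφ.measurable).integral_eq
    exact le_antisymm (hssd _ _ fun φ hφ _ => (heq φ hφ).le)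
      (hssd _ _ fun φ hφ _ => (heq φ hφ).ge)
  · intro hlaw Z₁ Z₂ hicv
    obtain ⟨f, hf, hZf⟩ := exists_boundedMeasurable_ae_eq Z₁
    obtain ⟨g, hg, hZg⟩ := exists_boundedMeasurable_ae_eq Z₂
    rw [← liftBounded_of_ae_eq U hf hZf, ← liftBounded_of_ae_eq U hg hZg]
    refine (isLawInvariantUtility_liftBounded hmono hconc husc hlaw).le_of_integral_min_le
      hatomless hf hg fun z => ?_
    have hle := hicv (fun x => min x z) (fun x y hxy => min_le_min_right z hxy)
      ((concaveOn_id convex_univ).inf (concaveOn_const z convex_univ))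
    have hcongr : ∀ (Z : Xinf μ) (u : Ω → ℝ), (Z : Ω → ℝ) =ᵐ[μ] u →
        ∫ ω, min (Z ω) z ∂μ = ∫ ω, min (u ω) z ∂μ :=
      fun _ _ h => integral_congr_ae (h.fun_comp fun x => min x z)
    rwa [hcongr _ _ hZf, hcongr _ _ hZg] at hle

end
end

section
/- Suppose that each U_i is concave and S.S.D. preserving, and that Assumption 1 holds. Then 𝒫𝒪 ≠ ∅ if and only if 𝒞𝒫𝒪 ≠ ∅. Furthermore, when Pareto optima and comonotone Pareto optima exist, for every λ ∈ Λ the supremum of ∑_{i=1}^n λ_i U_i(Y_i) over IR allocations equals its supremum over IR comonotone allocations. -/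
open MeasureTheory ProbabilityTheory Filter

noncomputable section

variable {Ω : Type*} [MeasurableSpace Ω] (μ : MeasureTheory.Measure Ω) [MeasureTheory.IsProbabilityMeasure μ]

variable {μ}

/-- The concave order on real functions: `g` dominates `f`. -/
def ConcaveLE (μ : Measure Ω) (f g : Ω → ℝ) : Prop :=
  ∀ φ : ℝ → ℝ, ConcaveOn ℝ Set.univ φ → ∫ ω, φ (f ω) ∂μ ≤ ∫ ω, φ (g ω) ∂μ

theorem continuous_of_concaveOn_univ {φ : ℝ → ℝ} (hφ : ConcaveOn ℝ Set.univ φ) :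
    Continuous φ :=
  continuousOn_univ.1 (hφ.continuousOn isOpen_univ)

theorem exists_norm_concave_le {φ : ℝ → ℝ} (hφ : ConcaveOn ℝ Set.univ φ) (M : ℝ) :
    ∃ C, ∀ x, |x| ≤ M → ‖φ x‖ ≤ C := by
  obtain ⟨C, hC⟩ := (isCompact_Icc (a := -M) (b := M)).exists_bound_of_continuousOn
    (continuous_of_concaveOn_univ hφ).continuousOn
  exact ⟨C, fun x hx => hC x (abs_le.1 hx)⟩

theorem integrable_concave_comp {φ : ℝ → ℝ} (hφ : ConcaveOn ℝ Set.univ φ) {f : Ω → ℝ}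
    (hf : AEStronglyMeasurable f μ) {M : ℝ} (hM : ∀ᵐ ω ∂μ, |f ω| ≤ M) :
    Integrable (fun ω => φ (f ω)) μ := by
  obtain ⟨C, hC⟩ := exists_norm_concave_le hφ M
  refine Integrable.of_bound
    ((continuous_of_concaveOn_univ hφ).comp_aestronglyMeasurable hf) C ?_
  filter_upwards [hM] with ω hω using hC _ hω

theorem ConcaveLE.abs_le {f g : Ω → ℝ} (h : ConcaveLE μ f g) (hg : Integrable g μ) {M : ℝ}
    (hM : ∀ᵐ ω ∂μ, |f ω| ≤ M) : ∀ᵐ ω ∂μ, |g ω| ≤ M := by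
  have hφ : ConcaveOn ℝ Set.univ (fun x : ℝ => min (M - |x|) 0) := by
    refine ConcaveOn.inf ?_ (concaveOn_const 0 convex_univ)
    exact (concaveOn_const M convex_univ).sub (convexOn_univ_norm (E := ℝ))
  have hint : Integrable (fun ω => min (M - |g ω|) 0) μ :=
    ((integrable_const M).sub hg.abs).inf (integrable_const 0)
  have h0 : 0 ≤ ∫ ω, min (M - |g ω|) 0 ∂μ := by
    refine le_trans (le_of_eq ?_) (h _ hφ)
    rw [integral_eq_zero_of_ae]
    filter_upwards [hM] with ω hω
    simpa using hω
  have hz : (fun ω => -min (M - |g ω|) 0) =ᵐ[μ] 0 := by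
    refine (integral_eq_zero_iff_of_nonneg (fun ω => ?_) hint.neg).1
      (le_antisymm ?_ (integral_nonneg fun ω => ?_))
    · simp
    · exact (integral_neg _).trans_le (neg_nonpos.2 h0)
    · simp
  filter_upwards [hz] with ω hω
  simpa using hω

theorem ConcaveLE.convex_comb {f g h : Ω → ℝ} (hfg : ConcaveLE μ f g) (hfh : ConcaveLE μ f h)
    (hg : Integrable g μ) (hh : Integrable h μ) {M : ℝ} (hM : ∀ᵐ ω ∂μ, |f ω| ≤ M)
    {a b : ℝ} (ha : 0 ≤ a) (hb : 0 ≤ b) (hab : a + b = 1) :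
    ConcaveLE μ f (fun ω => a * g ω + b * h ω) := by
  intro φ hφ
  have hgM := hfg.abs_le hg hM
  have hhM := hfh.abs_le hh hM
  have ig := (integrable_concave_comp hφ hg.1 hgM).const_mul a
  have ih := (integrable_concave_comp hφ hh.1 hhM).const_mul b
  have hcM : ∀ᵐ ω ∂μ, |a * g ω + b * h ω| ≤ M := by
    filter_upwards [hgM, hhM] with ω h1 h2
    rw [_root_.abs_le] at h1 h2 ⊢
    have hb' : b = 1 - a := by linarith
    subst hb'
    constructor <;> nlinarith
  have ic := integrable_concave_comp hφ ((hg.const_mul a).add (hh.const_mul b)).1 hcM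
  calc ∫ ω, φ (f ω) ∂μ
      = a * ∫ ω, φ (f ω) ∂μ + b * ∫ ω, φ (f ω) ∂μ := by rw [← add_mul, hab, one_mul]
    _ ≤ a * ∫ ω, φ (g ω) ∂μ + b * ∫ ω, φ (h ω) ∂μ :=
        add_le_add (mul_le_mul_of_nonneg_left (hfg φ hφ) ha)
          (mul_le_mul_of_nonneg_left (hfh φ hφ) hb)
    _ = ∫ ω, (a * φ (g ω) + b * φ (h ω)) ∂μ := by
        rw [integral_add ig ih, integral_const_mul, integral_const_mul]
    _ ≤ ∫ ω, φ (a * g ω + b * h ω) ∂μ :=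
        integral_mono (ig.add ih) ic fun ω => by
          simpa using hφ.2 (Set.mem_univ (g ω)) (Set.mem_univ (h ω)) ha hb hab

theorem isClosed_concaveLE {f : Ω → ℝ} {M : ℝ} (hM : ∀ᵐ ω ∂μ, |f ω| ≤ M) :
    IsClosed {g : Lp ℝ 2 μ | ConcaveLE μ f g} := by
  refine IsSeqClosed.isClosed fun u g hu hug φ hφ => ?_
  obtain ⟨ns, -, hns⟩ := (tendstoInMeasure_of_tendsto_Lp hug).exists_seq_tendsto_ae
  obtain ⟨C, hC⟩ := exists_norm_concave_le hφ M
  have hcont := continuous_of_concaveOn_univ hφ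
  have hlim : Tendsto (fun k => ∫ ω, φ (u (ns k) ω) ∂μ) atTop (nhds (∫ ω, φ (g ω) ∂μ)) := by
    refine tendsto_integral_of_dominated_convergence (fun _ => C)
      (fun k => hcont.comp_aestronglyMeasurable (Lp.aestronglyMeasurable _))
      (integrable_const C) (fun k => ?_) ?_
    · filter_upwards [(hu (ns k)).abs_le ((Lp.memLp _).integrable one_le_two) hM] with ω hω
        using hC _ hω
    · filter_upwards [hns] with ω hω using (hcont.tendsto _).comp hω
  exact ge_of_tendsto' hlim fun k => hu (ns k) φ hφ

/-- The zero-mean function taking the mass `r * μ A * μ B` from `A` and giving it to `B`. -/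
def massTransfer (μ : Measure Ω) (r : ℝ) (A B : Set Ω) (ω : Ω) : ℝ :=
  B.indicator (fun _ => r * μ.real A) ω - A.indicator (fun _ => r * μ.real B) ω

omit [IsProbabilityMeasure μ] in
theorem massTransfer_swap (r : ℝ) (A B : Set Ω) (ω : Ω) :
    massTransfer μ r B A ω = -massTransfer μ r A B ω := by
  simp [massTransfer]

theorem memLp_massTransfer (r : ℝ) {A B : Set Ω} (hA : MeasurableSet A) (hB : MeasurableSet B)
    (p : ENNReal) : MemLp (massTransfer μ r A B) p μ :=
  (memLp_indicator_const p hB _ (.inr (measure_ne_top _ _))).sub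
    (memLp_indicator_const p hA _ (.inr (measure_ne_top _ _)))

theorem integral_massTransfer (r : ℝ) {A B : Set Ω} (hA : MeasurableSet A)
    (hB : MeasurableSet B) : ∫ ω, massTransfer μ r A B ω ∂μ = 0 := by
  unfold massTransfer
  rw [integral_sub ((integrable_const _).indicator hB) ((integrable_const _).indicator hA),
    integral_indicator_const _ hB, integral_indicator_const _ hA]
  simp only [smul_eq_mul]
  ring

theorem abs_massTransfer_le {r : ℝ} (hr : 0 ≤ r) (A B : Set Ω) (ω : Ω) :
    |massTransfer μ r A B ω| ≤ r := by
  have hA : r * μ.real A ≤ r := mul_le_of_le_one_right hr measureReal_le_one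
  have hB : r * μ.real B ≤ r := mul_le_of_le_one_right hr measureReal_le_one
  have hA' : 0 ≤ r * μ.real A := by positivity
  have hB' : 0 ≤ r * μ.real B := by positivity
  unfold massTransfer
  by_cases h1 : ω ∈ A <;> by_cases h2 : ω ∈ B <;> simp [h1, h2, abs_le, -abs_mul] <;>
    first | (constructor <;> linarith) | linarith

/-- The increments of a concave function under moves towards `[c, d]` from either side are at
least those of its chord over `[c, d]`. -/
theorem concave_contraction_le {φ : ℝ → ℝ} (hφ : ConcaveOn ℝ Set.univ φ) {c d x y : ℝ}
    (hcd : c < d) (h : x = y ∨ (d < y ∧ y < x) ∨ (x < y ∧ y < c)) :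
    φ x + (φ d - φ c) / (d - c) * (y - x) ≤ φ y := by
  rcases h with rfl | ⟨h1, h2⟩ | ⟨h1, h2⟩
  · simp
  · have e1 := hφ.slope_anti_adjacent (Set.mem_univ c) (Set.mem_univ y) hcd h1
    have e2 := hφ.slope_anti_adjacent (Set.mem_univ d) (Set.mem_univ x) h1 h2
    have e3 := e2.trans e1
    rw [div_le_iff₀ (by linarith)] at e3
    linarith
  · have e1 := hφ.slope_anti_adjacent (Set.mem_univ y) (Set.mem_univ d) h2 hcd
    have e2 := hφ.slope_anti_adjacent (Set.mem_univ x) (Set.mem_univ c) h1 h2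
    have e3 := e1.trans e2
    rw [le_div_iff₀ (by linarith)] at e3
    linarith

theorem ConcaveLE.add_massTransfer {f z : Ω → ℝ} (hfz : ConcaveLE μ f z) (hz : Integrable z μ)
    {M : ℝ} (hM : ∀ᵐ ω ∂μ, |f ω| ≤ M) {a' a r : ℝ} (hr : 0 < r) (hra : 2 * r < a - a')
    {A B : Set Ω} (hA : MeasurableSet A) (hB : MeasurableSet B)
    (hA0 : 0 < μ.real A) (hB0 : 0 < μ.real B)
    (hzA : ∀ ω ∈ A, a < z ω) (hzB : ∀ ω ∈ B, z ω < a') :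
    ConcaveLE μ f (fun ω => z ω + massTransfer μ r A B ω) := by
  intro φ hφ
  refine (hfz φ hφ).trans ?_
  have hzM := hfz.abs_le hz hM
  have ih : Integrable (massTransfer μ r A B) μ :=
    (memLp_massTransfer r hA hB 1).integrable le_rfl
  have iz := integrable_concave_comp hφ hz.1 hzM
  have iw : Integrable (fun ω => φ (z ω + massTransfer μ r A B ω)) μ := by
    refine integrable_concave_comp hφ (hz.add ih).1 (M := M + r) ?_
    filter_upwards [hzM] with ω hω
    exact (abs_add_le _ _).trans (add_le_add hω (abs_massTransfer_le hr.le A B ω))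
  set p := (φ (a - r) - φ (a' + r)) / ((a - r) - (a' + r))
  have key : ∫ ω, (φ (z ω) + p * massTransfer μ r A B ω) ∂μ = ∫ ω, φ (z ω) ∂μ := by
    rw [integral_add iz (ih.const_mul p), integral_const_mul, integral_massTransfer r hA hB]
    simp
  rw [← key]
  refine integral_mono (iz.add (ih.const_mul p)) iw fun ω => ?_
  have hrA : r * μ.real A ≤ r := mul_le_of_le_one_right hr.le measureReal_le_one
  have hrB : r * μ.real B ≤ r := mul_le_of_le_one_right hr.le measureReal_le_one
  have hrA' : 0 < r * μ.real A := by positivity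
  have hrB' : 0 < r * μ.real B := by positivity
  have := concave_contraction_le hφ (c := a' + r) (d := a - r) (x := z ω)
    (y := z ω + massTransfer μ r A B ω) (by linarith) ?_
  · simpa using this
  · by_cases h1 : ω ∈ A <;> by_cases h2 : ω ∈ B
    · linarith [hzA ω h1, hzB ω h2]
    · refine .inr (.inl ?_)
      have := hzA ω h1
      simp only [massTransfer, h1, h2, Set.indicator_of_mem, Set.indicator_of_notMem,
        not_false_eq_true]
      constructor <;> linarith
    · refine .inr (.inr ?_)
      have := hzB ω h2
      simp only [massTransfer, h1, h2, Set.indicator_of_mem, Set.indicator_of_notMem,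
        not_false_eq_true]
      constructor <;> linarith
    · simp [massTransfer, h1, h2]

theorem integral_mul_massTransfer_neg {z : Ω → ℝ} (hz : Integrable z μ) {a' a r : ℝ}
    (hr : 0 < r) (haa : a' < a) {A B : Set Ω} (hA : MeasurableSet A) (hB : MeasurableSet B)
    (hA0 : 0 < μ.real A) (hB0 : 0 < μ.real B)
    (hzA : ∀ ω ∈ A, a < z ω) (hzB : ∀ ω ∈ B, z ω < a') :
    ∫ ω, z ω * massTransfer μ r A B ω ∂μ < 0 := by
  have ih : Integrable (massTransfer μ r A B) μ :=
    (memLp_massTransfer r hA hB 1).integrable le_rfl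
  have izh : Integrable (fun ω => z ω * massTransfer μ r A B ω) μ :=
    hz.mul_bdd (c := r) ih.1 (.of_forall fun ω => abs_massTransfer_le hr.le A B ω)
  have iB : Integrable (B.indicator fun _ => (a - a') * (r * μ.real A)) μ :=
    (integrable_const _).indicator hB
  have hle : ∫ ω, z ω * massTransfer μ r A B ω ∂μ ≤
      ∫ ω, (a * massTransfer μ r A B ω -
        B.indicator (fun _ => (a - a') * (r * μ.real A)) ω) ∂μ := by
    refine integral_mono izh ((ih.const_mul a).sub iB) fun ω => ?_
    have hrA' : 0 < r * μ.real A := by positivity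
    have hrB' : 0 < r * μ.real B := by positivity
    by_cases h1 : ω ∈ A <;> by_cases h2 : ω ∈ B
    · linarith [hzA ω h1, hzB ω h2]
    · have := hzA ω h1
      simp only [massTransfer, h1, h2, Set.indicator_of_mem, Set.indicator_of_notMem,
        not_false_eq_true]
      nlinarith
    · have := hzB ω h2
      simp only [massTransfer, h1, h2, Set.indicator_of_mem, Set.indicator_of_notMem,
        not_false_eq_true]
      nlinarith
    · simp [massTransfer, h1, h2]
  rw [integral_sub (ih.const_mul a) iB, integral_const_mul, integral_massTransfer r hA hB,
    integral_indicator_const _ hB, smul_eq_mul] at hle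
  have : 0 < μ.real B * ((a - a') * (r * μ.real A)) := by
    have : 0 < a - a' := by linarith
    positivity
  linarith

/-- Allocations of `∑ k, y k` improving on `y` in the concave order. -/
def concaveImprovements {n : ℕ} (y : Fin n → Lp ℝ 2 μ) :
    Set (PiLp 2 fun _ : Fin n => Lp ℝ 2 μ) :=
  {z | ∑ k, z k = ∑ k, y k ∧ ∀ k, ConcaveLE μ (y k) (z k)}

theorem integrable_of_Lp_two (f : Lp ℝ 2 μ) : Integrable f μ :=
  (Lp.memLp f).integrable one_le_two

omit [IsProbabilityMeasure μ] in
theorem ConcaveLE.congr_right {f g h : Ω → ℝ} (hfg : ConcaveLE μ f g) (hgh : g =ᵐ[μ] h) :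
    ConcaveLE μ f h := fun φ hφ =>
  (hfg φ hφ).trans_eq (integral_congr_ae (hgh.fun_comp φ))

theorem exists_minimal_improvement {n : ℕ} (y : Fin n → Lp ℝ 2 μ) {M : ℝ}
    (hM : ∀ k, ∀ᵐ ω ∂μ, |y k ω| ≤ M) :
    ∃ z ∈ concaveImprovements y, ∀ w ∈ concaveImprovements y,
      0 ≤ ∑ k, inner ℝ (z k) (w k - z k) := by
  have hne : (concaveImprovements y).Nonempty :=
    ⟨WithLp.toLp 2 y, rfl, fun k φ _ => le_rfl⟩
  have hconv : Convex ℝ (concaveImprovements y) := by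
    rintro z ⟨hz, hz'⟩ w ⟨hw, hw'⟩ a b ha hb hab
    refine ⟨?_, fun k => ?_⟩
    · simp [Finset.sum_add_distrib, ← Finset.smul_sum, hz, hw, ← add_smul, hab]
    · refine ((hz' k).convex_comb (hw' k) (integrable_of_Lp_two _) (integrable_of_Lp_two _)
        (hM k) ha hb hab).congr_right ?_
      filter_upwards [Lp.coeFn_add (a • z k) (b • w k), Lp.coeFn_smul a (z k),
        Lp.coeFn_smul b (w k)] with ω h1 h2 h3
      exact (h1.trans (congrArg₂ (· + ·) h2 h3)).symm
  have hclosed : IsClosed (concaveImprovements y) := by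
    have hk : ∀ k, Continuous fun z : PiLp 2 fun _ : Fin n => Lp ℝ 2 μ => z k :=
      fun k => PiLp.continuous_apply 2 _ k
    have heq : concaveImprovements y = {z | ∑ k, z k = ∑ k, y k} ∩
        ⋂ k, (fun z => z k) ⁻¹' {g : Lp ℝ 2 μ | ConcaveLE μ (y k) g} := by
      ext z
      simp [concaveImprovements]
    rw [heq]
    exact (isClosed_eq (continuous_finsetSum _ fun k _ => hk k) continuous_const).inter
      (isClosed_iInter fun k => (isClosed_concaveLE (hM k)).preimage (hk k))
  obtain ⟨z, hz, hmin⟩ :=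
    exists_norm_eq_iInf_of_complete_convex hne hclosed.isComplete hconv 0
  refine ⟨z, hz, fun w hw => ?_⟩
  have := (norm_eq_iInf_iff_real_inner_le_zero hconv hz).1 hmin w hw
  rw [zero_sub, inner_neg_left, PiLp.inner_apply] at this
  exact neg_nonpos.1 this

/-- Comonotonicity off a null set, from the absence of two events on which the order of two
coordinates is reversed by a rational margin. -/
theorem exists_comonotoneFun {n : ℕ} (z : Fin n → Ω → ℝ)
    (h : ∀ i j, i ≠ j → ∀ a' a b' b : ℚ, a' < a → b' < b →
      μ {ω | (a : ℝ) < z i ω ∧ z j ω < b'} = 0 ∨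
      μ {ω | z i ω < a' ∧ (b : ℝ) < z j ω} = 0) :
    ∃ Z : Fin n → Ω → ℝ, (∀ i, z i =ᵐ[μ] Z i) ∧ ComonotoneFun Z := by
  classical
  have hae : ∀ᵐ ω ∂μ, ∀ i j (a b : ℚ),
      (μ {ω | (a : ℝ) < z i ω ∧ z j ω < b} = 0 → ¬((a : ℝ) < z i ω ∧ z j ω < b)) := by
    simp only [ae_all_iff]
    intro i j a b h0
    simpa [ae_iff] using h0
  set G := {ω | ∀ i j (a b : ℚ),
      (μ {ω | (a : ℝ) < z i ω ∧ z j ω < b} = 0 → ¬((a : ℝ) < z i ω ∧ z j ω < b))}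
  have hcom : ∀ ω₁ ∈ G, ∀ ω₂ ∈ G, ∀ i j, ¬(z i ω₂ < z i ω₁ ∧ z j ω₁ < z j ω₂) := by
    rintro ω₁ h₁ ω₂ h₂ i j ⟨hi, hj⟩
    have hij : i ≠ j := by rintro rfl; exact lt_asymm hi hj
    obtain ⟨a', ha1, ha2⟩ := exists_rat_btwn hi
    obtain ⟨a, ha3, ha4⟩ := exists_rat_btwn ha2
    obtain ⟨b', hb1, hb2⟩ := exists_rat_btwn hj
    obtain ⟨b, hb3, hb4⟩ := exists_rat_btwn hb2
    rcases h i j hij a' a b' b (by exact_mod_cast ha3) (by exact_mod_cast hb3) with h0 | h0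
    · exact h₁ i j a b' h0 ⟨ha4, hb1⟩
    · exact h₂ j i b a' (by simpa only [and_comm] using h0) ⟨hb4, ha1⟩
  have hG : ∀ᵐ ω ∂μ, ω ∈ G := hae
  obtain ⟨ω₀, h₀⟩ := hG.exists
  let t : Ω → Ω := fun ω => if ω ∈ G then ω else ω₀
  have ht : ∀ ω, t ω ∈ G := fun ω => by
    by_cases hω : ω ∈ G <;> simp [t, hω, h₀]
  refine ⟨fun i ω => z i (t ω), fun i => ?_, fun i j ω₁ ω₂ => ?_⟩
  · filter_upwards [hG] with ω hω
    simp [t, hω]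
  · have h1 := hcom _ (ht ω₁) _ (ht ω₂) i j
    have h2 := hcom _ (ht ω₂) _ (ht ω₁) i j
    by_contra! hlt
    rcases mul_neg_iff.1 hlt with ⟨hp, hq⟩ | ⟨hp, hq⟩
    · exact h1 ⟨by linarith, by linarith⟩
    · exact h2 ⟨by linarith, by linarith⟩

theorem measure_eq_zero_or_of_minimal {n : ℕ} {y : Fin n → Lp ℝ 2 μ} {M : ℝ}
    (hM : ∀ k, ∀ᵐ ω ∂μ, |y k ω| ≤ M) {z : PiLp 2 fun _ : Fin n => Lp ℝ 2 μ}
    (hz : z ∈ concaveImprovements y)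
    (hmin : ∀ w ∈ concaveImprovements y, 0 ≤ ∑ k, inner ℝ (z k) (w k - z k))
    {i j : Fin n} (hij : i ≠ j) {a' a b' b : ℝ} (ha : a' < a) (hb : b' < b) :
    μ {ω | a < z i ω ∧ z j ω < b'} = 0 ∨ μ {ω | z i ω < a' ∧ b < z j ω} = 0 := by
  by_contra! hpos
  set A := {ω | a < z i ω ∧ z j ω < b'}
  set B := {ω | z i ω < a' ∧ b < z j ω}
  have mz : ∀ k, Measurable (z k : Ω → ℝ) := fun k => (Lp.stronglyMeasurable _).measurable
  have hA : MeasurableSet A :=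
    (measurableSet_lt measurable_const (mz i)).inter (measurableSet_lt (mz j) measurable_const)
  have hB : MeasurableSet B :=
    (measurableSet_lt (mz i) measurable_const).inter (measurableSet_lt measurable_const (mz j))
  have hA0 : 0 < μ.real A := ENNReal.toReal_pos hpos.1 (measure_ne_top _ _)
  have hB0 : 0 < μ.real B := ENNReal.toReal_pos hpos.2 (measure_ne_top _ _)
  set r := min (a - a') (b - b') / 3 with hrdef
  have hmp : 0 < min (a - a') (b - b') := lt_min (by linarith) (by linarith)
  have hr : 0 < r := by positivity
  have hra : 2 * r < a - a' := by
    have := min_le_left (a - a') (b - b')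
    linarith
  have hrb : 2 * r < b - b' := by
    have := min_le_right (a - a') (b - b')
    linarith
  let h : Lp ℝ 2 μ := (memLp_massTransfer r hA hB 2).toLp
  have hh : h =ᵐ[μ] massTransfer μ r A B := MemLp.coeFn_toLp _
  let w : PiLp 2 fun _ : Fin n => Lp ℝ 2 μ :=
    z + WithLp.toLp 2 (Pi.single i h - Pi.single j h)
  have hw : w ∈ concaveImprovements y := by
    refine ⟨?_, fun k => ?_⟩
    · simp [w, Finset.sum_add_distrib, hz.1]
    · by_cases hki : k = i
      · subst hki
        have hwk : w k = z k + h := by simp [w, hij]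
        rw [hwk]
        refine ((hz.2 k).add_massTransfer (integrable_of_Lp_two _) (hM k) hr hra hA hB hA0 hB0
          (fun ω hω => hω.1) (fun ω hω => hω.1)).congr_right ?_
        filter_upwards [Lp.coeFn_add (z k) h, hh] with ω h1 h2
        rw [h1, Pi.add_apply, h2]
      · by_cases hkj : k = j
        · subst hkj
          have hwk : w k = z k - h := by simp [w, hki, sub_eq_add_neg]
          rw [hwk]
          refine ((hz.2 k).add_massTransfer (integrable_of_Lp_two _) (hM k) hr hrb hB hA hB0 hA0
            (fun ω hω => hω.2) (fun ω hω => hω.2)).congr_right ?_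
          filter_upwards [Lp.coeFn_sub (z k) h, hh] with ω h1 h2
          rw [h1, Pi.sub_apply, h2, massTransfer_swap r A B, sub_eq_add_neg]
        · have hwk : w k = z k := by simp [w, hki, hkj]
          rw [hwk]
          exact hz.2 k
  have hsum : ∑ k, inner ℝ (z k) (w k - z k) = inner ℝ (z i) h - inner ℝ (z j) h := by
    have : ∀ k, w k - z k = (Pi.single i h - Pi.single j h : Fin n → Lp ℝ 2 μ) k :=
      fun k => add_sub_cancel_left (z k) _
    simp only [this, Pi.sub_apply, inner_sub_right, Finset.sum_sub_distrib]
    congr 1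
    · rw [Finset.sum_eq_single i] <;> simp +contextual
    · rw [Finset.sum_eq_single j] <;> simp +contextual
  have hinner : ∀ k, inner ℝ (z k) h = ∫ ω, z k ω * massTransfer μ r A B ω ∂μ := fun k => by
    rw [L2.inner_def]
    refine integral_congr_ae ?_
    filter_upwards [hh] with ω h1
    simp [h1, mul_comm]
  have hi := integral_mul_massTransfer_neg (integrable_of_Lp_two (z i)) hr ha hA hB hA0 hB0
    (fun ω hω => hω.1) (fun ω hω => hω.1)
  have hj := integral_mul_massTransfer_neg (integrable_of_Lp_two (z j)) hr hb hB hA hB0 hA0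
    (fun ω hω => hω.2) (fun ω hω => hω.2)
  simp only [massTransfer_swap r A B, mul_neg, integral_neg] at hj
  have := hmin w hw
  rw [hsum, hinner, hinner] at this
  linarith

/-- **Comonotone improvement**: every allocation is dominated in the concave order by a
comonotone allocation of the same aggregate. -/
theorem exists_comonotone_improvement {n : ℕ} (Y : Fin n → Xinf μ) :
    ∃ Y' : Fin n → Xinf μ, ∑ k, Y' k = ∑ k, Y k ∧ ComonotoneLp Y' ∧
      ∀ k, ConcaveLE μ (Y k) (Y' k) := by
  let y : Fin n → Lp ℝ 2 μ := fun k => ((Lp.memLp (Y k)).mono_exponent le_top).toLp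
  have hy : ∀ k, y k =ᵐ[μ] Y k := fun k => MemLp.coeFn_toLp _
  have hM : ∀ k, ∀ᵐ ω ∂μ, |y k ω| ≤ ∑ l, lpNorm (Y l) ⊤ μ := fun k => by
    filter_upwards [hy k, ae_le_lpNorm_exponent_top (Lp.memLp (Y k))] with ω h1 h2
    rw [h1]
    exact h2.trans (Finset.single_le_sum (f := fun l => lpNorm (Y l) ⊤ μ)
      (fun l _ => lpNorm_nonneg) (Finset.mem_univ k))
  obtain ⟨z, hz, hmin⟩ := exists_minimal_improvement y hM
  let Y' : Fin n → Xinf μ := fun k => (memLp_top_of_bound (Lp.aestronglyMeasurable (z k)) _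
    ((hz.2 k).abs_le (integrable_of_Lp_two _) (hM k))).toLp
  have hY' : ∀ k, Y' k =ᵐ[μ] z k := fun k => MemLp.coeFn_toLp _
  refine ⟨Y', Lp.ext ?_, ?_, fun k φ hφ => ?_⟩
  · have hsum : ((∑ k, z k : Lp ℝ 2 μ) : Ω → ℝ) =ᵐ[μ] (∑ k, y k : Lp ℝ 2 μ) := by rw [hz.1]
    filter_upwards [hsum, Lp.coeFn_finsetSum Finset.univ Y', Lp.coeFn_finsetSum Finset.univ Y,
      Lp.coeFn_finsetSum Finset.univ (fun k => z k), Lp.coeFn_finsetSum Finset.univ y,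
      ae_all_iff.2 hY', ae_all_iff.2 hy] with ω h h1 h2 h3 h4 h5 h6
    rw [h3, h4] at h
    rw [h1, h2]
    simpa [h5, h6] using h
  · obtain ⟨Z, hZ, hcom⟩ := exists_comonotoneFun (μ := μ) (fun k => (z k : Ω → ℝ))
      fun i j hij a' a b' b ha hb => measure_eq_zero_or_of_minimal hM hz hmin hij
        (by exact_mod_cast ha) (by exact_mod_cast hb)
    exact ⟨Z, fun k => (hY' k).trans (hZ k), hcom⟩
  · exact (integral_congr_ae ((hy k).fun_comp φ)).symm.trans_le
      ((hz.2 k).congr_right (hY' k).symm φ hφ)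

theorem exists_comonotone_IR_improvement {n : ℕ} {U : Fin n → Xinf μ → ℝ} {X : Fin n → Xinf μ}
    (hSSD : ∀ i, SSDPreserving (U i)) {Y : Fin n → Xinf μ} (hY : Y ∈ IRset U X) :
    ∃ Y' ∈ IRset U X, ComonotoneLp Y' ∧ ∀ i, U i (Y i) ≤ U i (Y' i) := by
  obtain ⟨Y', hsum, hcom, hle⟩ := exists_comonotone_improvement Y
  have hU : ∀ i, U i (Y i) ≤ U i (Y' i) := fun i => hSSD i _ _ fun φ _ hφ => hle i φ hφ
  exact ⟨Y', ⟨hsum.trans hY.1, fun i => (hY.2 i).trans (hU i)⟩, hcom, hU⟩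

/-- If each `U i` is concave and S.S.D. preserving and Assumption 1 holds, then
Pareto optima exist iff comonotone Pareto optima exist; and when both exist, for every
`λ ∈ Λ` the supremum of the `λ`-weighted sum of utilities over IR allocations equals its
supremum over IR comonotone allocations. -/
theorem PO_nonempty_iff_CPO_nonempty_and_sup_eq
    (hatomless : AtomlessMeasure μ) {n : ℕ} (hn : 0 < n)
    (U : Fin n → Xinf μ → ℝ) (X : Fin n → Xinf μ)
    (hA1 : Assumption1 U)
    (hconc : ∀ i, ConcaveOn ℝ Set.univ (U i)) (hSSD : ∀ i, SSDPreserving (U i)) :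
    ((POset U X).Nonempty ↔ (CPOset U X).Nonempty) ∧
    ((POset U X).Nonempty → (CPOset U X).Nonempty →
      ∀ lam : Fin n → ℝ, (∀ i, 0 ≤ lam i) → lam ≠ 0 →
        sSup {r : ℝ | ∃ Y ∈ IRset U X, r = ∑ i, lam i * U i (Y i)} =
          sSup {r : ℝ | ∃ Y ∈ IRset U X, ComonotoneLp Y ∧ r = ∑ i, lam i * U i (Y i)}) := by
  have himp : ∀ Y ∈ IRset U X, ∃ Y' ∈ IRset U X, ComonotoneLp Y' ∧ ∀ i, U i (Y i) ≤ U i (Y' i) :=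
    fun Y hY => exists_comonotone_IR_improvement hSSD hY
  refine ⟨⟨?_, ?_⟩, fun _ _ lam hlam _ => ?_⟩
  · rintro ⟨Y, hY, hopt⟩
    obtain ⟨Y', hY', hcom, hle⟩ := himp Y hY
    exact ⟨Y', hY', hcom, fun ⟨W, hW, _, hge, j, hj⟩ =>
      hopt ⟨W, hW, fun i => (hle i).trans (hge i), j, (hle j).trans_lt hj⟩⟩
  · rintro ⟨Y, hY, _, hopt⟩
    refine ⟨Y, hY, fun ⟨W, hW, hge, j, hj⟩ => ?_⟩
    obtain ⟨W', hW', hcom', hle⟩ := himp W hW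
    exact hopt ⟨W', hW', hcom', fun i => (hge i).trans (hle i), j, hj.trans_le (hle j)⟩
  · set s := {r : ℝ | ∃ Y ∈ IRset U X, r = ∑ i, lam i * U i (Y i)}
    set t := {r : ℝ | ∃ Y ∈ IRset U X, ComonotoneLp Y ∧ r = ∑ i, lam i * U i (Y i)}
    have hts : t ⊆ s := fun r ⟨Y, hY, _, hr⟩ => ⟨Y, hY, hr⟩
    have hst : ∀ r ∈ s, ∃ q ∈ t, r ≤ q := by
      rintro _ ⟨Y, hY, rfl⟩
      obtain ⟨Y', hY', hcom, hle⟩ := himp Y hY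
      exact ⟨_, ⟨Y', hY', hcom, rfl⟩,
        Finset.sum_le_sum fun i _ => mul_le_mul_of_nonneg_left (hle i) (hlam i)⟩
    refine csSup_eq_csSup_of_forall_exists_le hst fun r hr => ⟨r, hts hr, le_rfl⟩

end
end
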